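/- arXiv:1903.01068 — 3 statements merged into one kernel-verified Lean document; each statement's English description precedes it below -/
import Mathlib

section
/- For every integer r ≥ 3 and every α ∈ (0,1) there exist an integer m = m(r), depending only on r, and a real number β = β(α, r) ∈ (0,1) with the following property: if (X, 𝒞) is a convexity space with Radon number at most r, and F is a family of n ≥ m convex sets of 𝒞 such that at least α·binom(n, m) of the m-element subsets of F have nonempty intersection, then there is a subfamily of F of size at least β·n whose members have a common point. -/
open scoped Classical

/-- A convexity space on a ground set `X`: a finite family of "convex" subsets of `X`
containing `∅` and `X` and closed under pairwise intersections. -/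
structure ConvexitySpace (X : Type*) where
  sets : Finset (Set X)
  empty_mem : ∅ ∈ sets
  univ_mem : Set.univ ∈ sets
  inter_mem : ∀ A ∈ sets, ∀ B ∈ sets, A ∩ B ∈ sets

namespace ConvexitySpace

variable {X : Type*}

/-- The convex hull of `Y`: the intersection of all convex sets containing `Y`. -/
def hull (CS : ConvexitySpace X) (Y : Set X) : Set X :=
  ⋂₀ {S : Set X | S ∈ CS.sets ∧ Y ⊆ S}

/-- The convexity space has Radon number at most `r`: every set of at least `r` points
can be partitioned into two parts whose convex hulls intersect. -/
def RadonLE (CS : ConvexitySpace X) (r : ℕ) : Prop :=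
  ∀ P : Finset X, r ≤ P.card →
    ∃ P₁ P₂ : Finset X, P₁ ∪ P₂ = P ∧ Disjoint P₁ P₂ ∧
      (CS.hull ↑P₁ ∩ CS.hull ↑P₂).Nonempty

end ConvexitySpace

namespace ConvexitySpace

variable {X : Type*}

theorem hull_subset (CS : ConvexitySpace X) {Y S : Set X} (hS : S ∈ CS.sets) (h : Y ⊆ S) :
    CS.hull Y ⊆ S := fun _ hx => hx S ⟨hS, h⟩

theorem subset_hull (CS : ConvexitySpace X) (Y : Set X) : Y ⊆ CS.hull Y :=
  fun _ hx _ hS => hS.2 hx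

theorem hull_mono (CS : ConvexitySpace X) {Y Z : Set X} (h : Y ⊆ Z) : CS.hull Y ⊆ CS.hull Z :=
  fun _ hx S hS => hx S ⟨hS.1, h.trans hS.2⟩

theorem hull_hull (CS : ConvexitySpace X) {Y Z : Set X} (h : Y ⊆ CS.hull Z) :
    CS.hull Y ⊆ CS.hull Z :=
  fun _ hx S hS => hx S ⟨hS.1, fun _ hy => h hy S hS⟩

/-- Indexed Tverberg property. -/
def Tv (CS : ConvexitySpace X) (ι κ : Type) : Prop :=
  ∀ q : ι → X, ∃ f : ι → κ, ∃ z, ∀ j, z ∈ CS.hull (q '' {t | f t = j})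

theorem Tv.prod {CS : ConvexitySpace X} {ι κ ι' κ' : Type} (h : CS.Tv ι κ) (h' : CS.Tv ι' κ') :
    CS.Tv (ι × ι') (κ × κ') := by
  intro q
  choose f x hx using fun g : ι' => h (fun t => q (t, g))
  obtain ⟨f', z, hz⟩ := h' x
  refine ⟨fun p => (f p.2 p.1, f' p.2), z, ?_⟩
  rintro ⟨j, j'⟩
  refine CS.hull_hull ?_ (hz j')
  rintro _ ⟨g, hg, rfl⟩
  refine CS.hull_mono ?_ (hx g j)
  rintro _ ⟨t, ht, rfl⟩
  refine ⟨(t, g), ?_, rfl⟩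
  simp only [Set.mem_ofPred_eq] at hg ht ⊢
  rw [ht, hg]

theorem Tv.congr {CS : ConvexitySpace X} {ι κ ι' κ' : Type} (h : CS.Tv ι κ) (e : ι ≃ ι')
    (e' : κ ≃ κ') : CS.Tv ι' κ' := by
  intro q
  obtain ⟨f, z, hz⟩ := h (q ∘ e)
  refine ⟨fun t => e' (f (e.symm t)), z, fun j => CS.hull_mono ?_ (hz (e'.symm j))⟩
  rintro _ ⟨t, ht, rfl⟩
  refine ⟨e t, ?_, rfl⟩
  simp only [Set.mem_ofPred_eq] at ht ⊢
  simp [ht]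

theorem tv_base {CS : ConvexitySpace X} {r : ℕ} (hR : CS.RadonLE r) : CS.Tv (Fin r) (Fin 2) := by
  intro q
  by_cases hq : Function.Injective q
  · obtain ⟨P₁, P₂, hU, hd, z, hz1, hz2⟩ := hR (Finset.univ.image q) (by
      rw [Finset.card_image_of_injective _ hq]; simp)
    refine ⟨fun t => if q t ∈ P₁ then 0 else 1, z, ?_⟩
    have key : ∀ x, x ∈ P₁ ∨ x ∈ P₂ → ∃ t, q t = x := by
      intro x hx
      have : x ∈ Finset.univ.image q := by rw [← hU]; simpa using hx
      simpa using this
    intro j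
    fin_cases j
    · refine CS.hull_mono ?_ hz1
      intro x hx
      obtain ⟨t, rfl⟩ := key x (Or.inl hx)
      refine ⟨t, ?_, rfl⟩
      have : q t ∈ P₁ := hx
      simp [this]
    · refine CS.hull_mono ?_ hz2
      intro x hx
      obtain ⟨t, rfl⟩ := key x (Or.inr hx)
      refine ⟨t, ?_, rfl⟩
      have : q t ∉ P₁ := fun h => Finset.disjoint_left.mp hd h hx
      simp [this]
  · simp only [Function.Injective, not_forall] at hq
    obtain ⟨a, b, hab, hne⟩ := hq
    refine ⟨fun t => if t = a then 0 else 1, q a, ?_⟩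
    intro j
    apply CS.subset_hull
    fin_cases j
    · exact ⟨a, by simp, rfl⟩
    · exact ⟨b, by simp [Ne.symm hne], hab.symm⟩

theorem tv_pow {CS : ConvexitySpace X} {r : ℕ} (hR : CS.RadonLE r) (l : ℕ) :
    CS.Tv (Fin (r ^ l)) (Fin (2 ^ l)) := by
  induction l with
  | zero =>
    intro q
    refine ⟨fun _ => ⟨0, by simp⟩, q ⟨0, by simp⟩, fun j => ?_⟩
    apply CS.subset_hull
    refine ⟨_, ?_, rfl⟩
    apply Fin.ext
    have := j.2
    simp at this ⊢
  | succ l ih =>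
    exact (ih.prod (tv_base hR)).congr
      (finProdFinEquiv.trans (finCongr (by rw [pow_succ])))
      (finProdFinEquiv.trans (finCongr (by rw [pow_succ])))

/-- Helly theorem, indexed form. -/
theorem helly [Nonempty X] {CS : ConvexitySpace X} {r k : ℕ} (hR : CS.RadonLE r) (hk : r ≤ k)
    {ι : Type*} [Finite ι] (C : ι → Set X) (hC : ∀ i, C i ∈ CS.sets)
    (hne : ¬ (⋂ i, C i).Nonempty) : ∃ φ : Fin k → ι, ¬ (⋂ a, C (φ a)).Nonempty := by
  have := Fintype.ofFinite ι
  obtain ⟨s, hs⟩ : ∃ s : Finset ι, Minimal (fun s : Finset ι => ¬ (⋂ i ∈ s, C i).Nonempty) s := by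
    have : (Set.univ.toFinset.filter (fun s : Finset ι => ¬ (⋂ i ∈ s, C i).Nonempty)).Nonempty :=
      ⟨Finset.univ, by simpa using hne⟩
    obtain ⟨s, hs⟩ := Finset.exists_minimal this
    refine ⟨s, ?_⟩
    simpa using hs
  have hs0 : s.Nonempty := by
    rw [Finset.nonempty_iff_ne_empty]
    rintro rfl
    apply hs.prop
    simp
  have hcard : s.card ≤ k := by
    by_contra hlt
    push Not at hlt
    have hp : ∀ i : ι, ∃ x, i ∈ s → ∀ j ∈ s, j ≠ i → x ∈ C j := by
      intro i
      by_cases hi : i ∈ s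
      · have : (⋂ j ∈ s.erase i, C j).Nonempty := by
          by_contra hcon
          have h1 := hs.le_of_le hcon (Finset.erase_subset i s)
          exact Finset.notMem_erase i s (h1 hi)
        obtain ⟨x, hx⟩ := this
        refine ⟨x, fun _ j hj hji => ?_⟩
        simp only [Set.mem_iInter] at hx
        exact hx j (Finset.mem_erase.mpr ⟨hji, hj⟩)
      · exact ⟨Classical.arbitrary X, fun h => absurd h hi⟩
    choose p hp using hp
    have hinj : Set.InjOn p s := by
      intro i hi i' hi' h
      by_contra hne'
      apply hs.prop
      refine ⟨p i, ?_⟩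
      simp only [Set.mem_iInter]
      intro j hj
      by_cases hji : j = i
      · rw [h]
        exact hp i' hi' j hj (by rw [hji]; exact hne')
      · exact hp i hi j hj hji
    obtain ⟨P₁, P₂, hU, hd, z, hz1, hz2⟩ := hR (s.image p) (by
      rw [Finset.card_image_of_injOn hinj]; omega)
    apply hs.prop
    refine ⟨z, ?_⟩
    simp only [Set.mem_iInter]
    intro i hi
    have aux : ∀ Q : Finset X, Q ⊆ s.image p → p i ∉ Q → CS.hull Q ⊆ C i := by
      intro Q hQ hpi
      apply CS.hull_subset (hC i)
      intro x hx
      obtain ⟨i', hi', rfl⟩ := Finset.mem_image.mp (hQ hx)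
      apply hp i' hi' i hi
      rintro rfl
      exact hpi hx
    by_cases h1 : p i ∈ P₁
    · exact aux P₂ (by rw [← hU]; exact Finset.subset_union_right)
        (Finset.disjoint_left.mp hd h1) hz2
    · exact aux P₁ (by rw [← hU]; exact Finset.subset_union_left) h1 hz1
  obtain ⟨φ, hφ⟩ : ∃ φ : Fin k → s, Function.Surjective φ := by
    have : Nonempty s := hs0.to_subtype
    have e : Fin s.card ≃ s := s.equivFin.symm
    refine ⟨fun a => if h : (a : ℕ) < s.card then e ⟨a, h⟩ else Classical.arbitrary _, ?_⟩
    intro i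
    refine ⟨⟨e.symm i, lt_of_lt_of_le (e.symm i).2 hcard⟩, ?_⟩
    simp
  refine ⟨fun a => φ a, ?_⟩
  rintro ⟨x, hx⟩
  apply hs.prop
  refine ⟨x, ?_⟩
  simp only [Set.mem_iInter] at hx ⊢
  intro i hi
  obtain ⟨a, ha⟩ := hφ ⟨i, hi⟩
  have := hx a
  rwa [ha] at this

/-- Colorful Helly, blocks of size `k`. -/
theorem colorful {CS : ConvexitySpace X} {T k : ℕ} (h : CS.Tv (Fin T) (Fin k))
    (W : Fin (k ^ T) → Fin k → Set X) (hW : ∀ i j, W i j ∈ CS.sets)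
    (hs : ∀ s : Fin (k ^ T) → Fin k, (⋂ i, W i (s i)).Nonempty) :
    ∃ i, (⋂ j, W i j).Nonempty := by
  have e : (Fin T → Fin k) ≃ Fin (k ^ T) := finFunctionFinEquiv
  choose p hp using hs
  obtain ⟨f, z, hz⟩ := h (fun t => p (fun i => e.symm i t))
  refine ⟨e f, z, ?_⟩
  simp only [Set.mem_iInter] at hp ⊢
  intro j
  refine CS.hull_subset (hW _ _) ?_ (hz j)
  rintro _ ⟨t, ht, rfl⟩
  have := hp (fun i => e.symm i t) (e f)
  simp only [Equiv.symm_apply_apply] at this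
  rwa [show f t = j from ht] at this

/-- Colorful Helly, blocks of arbitrary size. -/
theorem colorful' [Nonempty X] {CS : ConvexitySpace X} {r T k : ℕ} (hR : CS.RadonLE r)
    (hk : r ≤ k) (h : CS.Tv (Fin T) (Fin k)) {b : ℕ}
    (W : Fin (k ^ T) → Fin b → Set X) (hW : ∀ i j, W i j ∈ CS.sets)
    (hs : ∀ s : Fin (k ^ T) → Fin b, (⋂ i, W i (s i)).Nonempty) :
    ∃ i, (⋂ j, W i j).Nonempty := by
  by_contra hcon
  push Not at hcon
  have := fun i => helly hR hk (W i) (hW i) (by rw [hcon i]; simp)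
  choose φ hφ using this
  obtain ⟨i, hi⟩ := colorful h (fun i a => W i (φ i a)) (fun i a => hW _ _)
    (fun s => hs (fun i => φ i (s i)))
  exact hφ i hi

end ConvexitySpace

/-- Density step: either a large set in which almost all `k`-tuples are good, or
bad blocks all of whose transversals lie in `R`. -/
theorem density_step (k m : ℕ) (δ : ℝ) (hδ : 0 < δ) : ∀ α : ℝ, 0 < α →
    ∃ α' : ℝ, 0 < α' ∧ ∀ (V : Type*) [Fintype V] [Nonempty V] (R : Finset (Fin m → V))
      (B : Finset (Fin k → V)), α * (Fintype.card V : ℝ) ^ m ≤ R.card →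
      (∃ D : Finset V, α' * (Fintype.card V : ℝ) ≤ D.card ∧
        ((B.filter (fun w => ∀ j, w j ∈ D)).card : ℝ) ≤ δ * (D.card : ℝ) ^ k) ∨
      (∃ W : Fin m → Fin k → V, (∀ i, W i ∈ B) ∧ ∀ s : Fin m → Fin k, (fun i => W i (s i)) ∈ R) := by
  induction m with
  | zero =>
    intro α hα
    refine ⟨1, one_pos, fun V _ _ R B hR => Or.inr ⟨fun i => i.elim0, fun i => i.elim0, fun s => ?_⟩⟩
    have : R.Nonempty := by
      rw [← Finset.card_pos]
      have : (0 : ℝ) < R.card := by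
        refine lt_of_lt_of_le hα ?_
        simpa using hR
      exact_mod_cast this
    obtain ⟨x, hx⟩ := this
    convert hx
  | succ m ih =>
    intro α hα
    obtain ⟨α'', hα'', H⟩ := ih (α / 2 * (δ * (α / 2) ^ k)) (by positivity)
    refine ⟨min (α / 2) α'', by positivity, fun V _ _ R B hR => ?_⟩
    set n : ℝ := (Fintype.card V : ℝ) with hn
    have hnpos : 0 < n := by
      rw [hn]
      exact_mod_cast Fintype.card_pos
    have hn0 : 0 ≤ n := hnpos.le
    let D : (Fin m → V) → Finset V := fun e => Finset.univ.filter (fun v => (Fin.cons v e : Fin (m + 1) → V) ∈ R)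
    have hsum : ∑ e : Fin m → V, ((D e).card : ℝ) = R.card := by
      have : ∑ e : Fin m → V, (D e).card = R.card := by
        rw [← Finset.card_sigma]
        refine Finset.card_bij (fun x _ => Fin.cons x.2 x.1) ?_ ?_ ?_
        · rintro ⟨e, v⟩ h
          simpa [D] using h
        · rintro ⟨e, v⟩ _ ⟨e', v'⟩ _ h
          obtain ⟨h1, h2⟩ := Fin.cons_injective2 (α := fun _ => V) h
          simp only at h1 h2
          rw [h1, h2]
        · intro x hx
          refine ⟨⟨Fin.tail x, x 0⟩, ?_, ?_⟩
          · simpa [D] using hx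
          · simp
      exact_mod_cast this
    by_cases hcase : ∃ e, α / 2 * n ≤ (D e).card ∧
        ((B.filter (fun w => ∀ j, w j ∈ D e)).card : ℝ) ≤ δ * ((D e).card : ℝ) ^ k
    · obtain ⟨e, he1, he2⟩ := hcase
      exact Or.inl ⟨D e, (mul_le_mul_of_nonneg_right (min_le_left _ _) hn0).trans he1, he2⟩
    push Not at hcase
    let S : Finset (Fin m → V) := Finset.univ.filter (fun e => α / 2 * n ≤ (D e).card)
    have hV : (Fintype.card (Fin m → V) : ℝ) = n ^ m := by simp [hn]
    have hS : α / 2 * n ^ (m + 1) ≤ S.card * n := by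
      have h1 : ∑ e : Fin m → V, ((D e).card : ℝ) ≤
          ∑ e : Fin m → V, (α / 2 * n + if e ∈ S then n else 0) := by
        apply Finset.sum_le_sum
        intro e _
        by_cases he : e ∈ S
        · simp only [he, if_true]
          have : ((D e).card : ℝ) ≤ n := by
            rw [hn]
            exact_mod_cast Finset.card_le_univ _
          have : 0 ≤ α / 2 * n := by positivity
          linarith
        · simp only [he, if_false]
          simp only [S, Finset.mem_filter, Finset.mem_univ, true_and, not_le] at he
          linarith
      rw [hsum, Finset.sum_add_distrib] at h1
      simp only [Finset.sum_const, Finset.card_univ, nsmul_eq_mul, hV, Finset.sum_ite_mem,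
        Finset.univ_inter] at h1
      rw [pow_succ] at hR ⊢
      linarith
    have hpairs : ((α / 2 * n ^ m) * (δ * (α / 2 * n) ^ k)) ≤
        ∑ w ∈ B, ((Finset.univ.filter (fun e => ∀ j, w j ∈ D e)).card : ℝ) := by
      have h2 : ∑ w ∈ B, ((Finset.univ.filter (fun e => ∀ j, w j ∈ D e)).card : ℝ) =
          ∑ e : Fin m → V, ((B.filter (fun w => ∀ j, w j ∈ D e)).card : ℝ) := by
        simp only [Finset.card_filter, Nat.cast_sum]
        rw [Finset.sum_comm]
      rw [h2]
      have h3 : ∑ e ∈ S, δ * (α / 2 * n) ^ k ≤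
          ∑ e : Fin m → V, ((B.filter (fun w => ∀ j, w j ∈ D e)).card : ℝ) := by
        refine le_trans ?_ (Finset.sum_le_sum_of_subset_of_nonneg (Finset.subset_univ S)
          (fun _ _ _ => by positivity))
        apply Finset.sum_le_sum
        intro e he
        simp only [S, Finset.mem_filter, Finset.mem_univ, true_and] at he
        refine le_trans ?_ (hcase e he).le
        gcongr
      refine le_trans ?_ h3
      rw [Finset.sum_const, nsmul_eq_mul]
      refine mul_le_mul_of_nonneg_right ?_ (by positivity)
      rw [pow_succ, ← mul_assoc] at hS
      exact le_of_mul_le_mul_right hS hnpos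
    obtain ⟨w, hwB, hw⟩ : ∃ w ∈ B, (α / 2 * (δ * (α / 2) ^ k)) * n ^ m ≤
        ((Finset.univ.filter (fun e => ∀ j, w j ∈ D e)).card : ℝ) := by
      have hB : B.Nonempty := by
        rw [Finset.nonempty_iff_ne_empty]
        rintro rfl
        rw [Finset.sum_empty] at hpairs
        have : 0 < (α / 2 * n ^ m) * (δ * (α / 2 * n) ^ k) := by positivity
        linarith
      refine Finset.exists_le_of_sum_le hB (le_trans ?_ hpairs)
      rw [Finset.sum_const, nsmul_eq_mul]
      have hBc : (B.card : ℝ) ≤ n ^ k := by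
        have h4 : (B.card : ℝ) ≤ (Fintype.card (Fin k → V) : ℝ) := by
          exact_mod_cast Finset.card_le_univ B
        refine h4.trans (le_of_eq ?_)
        simp [hn]
      calc (B.card : ℝ) * ((α / 2 * (δ * (α / 2) ^ k)) * n ^ m)
          ≤ n ^ k * ((α / 2 * (δ * (α / 2) ^ k)) * n ^ m) :=
            mul_le_mul_of_nonneg_right hBc (by positivity)
        _ = _ := by rw [mul_pow]; ring
    rcases H V _ B hw with ⟨D', h1, h2⟩ | ⟨W, h1, h2⟩
    · exact Or.inl ⟨D', (mul_le_mul_of_nonneg_right (min_le_right _ _) hn0).trans h1, h2⟩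
    · refine Or.inr ⟨Fin.cons w W, ?_, ?_⟩
      · intro i
        refine Fin.cases ?_ (fun i => ?_) i
        · simpa using hwB
        · simpa using h1 i
      · intro s
        have := h2 (Fin.tail s)
        simp only [D, Finset.mem_filter, Finset.mem_univ, true_and] at this
        convert this (s 0) using 1
        funext i
        refine Fin.cases ?_ (fun i => ?_) i <;> simp [Fin.tail]

/-- Greedy extraction of disjoint bad blocks. -/
theorem greedy_blocks {V : Type*} (k : ℕ) (hk : 0 < k) (Good : Finset V → Prop)
    (D : Finset V)
    (hH : ∀ s : Finset V, ¬ Good s → ∃ φ : Fin k → V, (∀ a, φ a ∈ s) ∧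
      ¬ Good (Finset.univ.image φ))
    (hD : ∀ G ⊆ D, (D.card : ℝ) / 2 ≤ G.card → ¬ Good G) :
    ∃ N : ℕ, (D.card : ℝ) ≤ 2 * k * N ∧ ∃ W : Fin N → Fin k → V,
      (∀ i a, W i a ∈ D) ∧ (∀ i, ¬ Good (Finset.univ.image (W i))) ∧
      ∀ i i' a a', W i a = W i' a' → i = i' := by
  have key : ∀ N : ℕ, (∃ N : ℕ, (D.card : ℝ) ≤ 2 * k * N ∧ ∃ W : Fin N → Fin k → V,
      (∀ i a, W i a ∈ D) ∧ (∀ i, ¬ Good (Finset.univ.image (W i))) ∧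
      ∀ i i' a a', W i a = W i' a' → i = i') ∨ ∃ W : Fin N → Fin k → V,
      (∀ i a, W i a ∈ D) ∧ (∀ i, ¬ Good (Finset.univ.image (W i))) ∧
      ∀ i i' a a', W i a = W i' a' → i = i' := by
    intro N
    induction N with
    | zero =>
      right
      exact ⟨fun i => i.elim0, fun i => i.elim0, fun i => i.elim0, fun i => i.elim0⟩
    | succ N ih =>
      rcases ih with ih | ⟨W, h1, h2, h3⟩
      · exact Or.inl ih
      by_cases hN : (D.card : ℝ) ≤ 2 * k * N
      · exact Or.inl ⟨N, hN, W, h1, h2, h3⟩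
      right
      push Not at hN
      let U : Finset V := Finset.univ.image (fun p : Fin N × Fin k => W p.1 p.2)
      have hU : U.card ≤ N * k := by
        refine Finset.card_image_le.trans ?_
        simp
      have hrest : ((D.card : ℝ)) / 2 ≤ (D \ U).card := by
        have h4 : D.card ≤ (D \ U).card + U.card := by
          have := Finset.le_card_sdiff U D
          omega
        have h5 : (D.card : ℝ) ≤ (D \ U).card + N * k := by
          exact_mod_cast h4.trans (Nat.add_le_add_left hU _)
        nlinarith
      obtain ⟨φ, hφ, hφ2⟩ := hH _ (hD _ Finset.sdiff_subset hrest)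
      have hnot : ∀ a i a', φ a ≠ W i a' := by
        intro a i a' h
        have := (Finset.mem_sdiff.mp (hφ a)).2
        apply this
        rw [h]
        exact Finset.mem_image.mpr ⟨(i, a'), Finset.mem_univ _, rfl⟩
      refine ⟨Fin.cons φ W, ?_, ?_, ?_⟩
      · intro i
        refine Fin.cases ?_ (fun i => ?_) i
        · simpa using fun a => (Finset.mem_sdiff.mp (hφ a)).1
        · simpa using h1 i
      · intro i
        refine Fin.cases ?_ (fun i => ?_) i
        · simpa using hφ2
        · simpa using h2 i
      · intro i i' a a'
        refine Fin.cases ?_ (fun i => ?_) i <;> refine Fin.cases ?_ (fun i' => ?_) i'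
        · simp
        · simpa using fun h => (hnot _ _ _ h).elim
        · simpa using fun h => (hnot _ _ _ h.symm).elim
        · simpa using h3 i i' a a'
  rcases key D.card with h | ⟨W, h⟩
  · exact h
  · refine ⟨D.card, ?_, W, h⟩
    have : (1 : ℝ) ≤ k := by exact_mod_cast hk
    have h0 : (0 : ℝ) ≤ D.card := by positivity
    nlinarith

/-- Dense case. -/
theorem dense_case {X : Type*} [Nonempty X] {CS : ConvexitySpace X} {r T k : ℕ}
    (hR : CS.RadonLE r) (hk : r ≤ k) (hk0 : 0 < k) (hT : CS.Tv (Fin T) (Fin k))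
    {V : Type*} [Fintype V] (C : V → Set X) (hC : ∀ v, C v ∈ CS.sets)
    (D : Finset V) (hD0 : D.Nonempty) (δ : ℝ) (hδ : δ * (2 * k) ^ (k ^ T) < 1) (hδ0 : 0 ≤ δ)
    (B : Finset (Fin (k ^ T) → V)) (hB : ∀ x, ¬ (⋂ i, C (x i)).Nonempty → x ∈ B)
    (hBD : ((B.filter (fun w => ∀ j, w j ∈ D)).card : ℝ) ≤ δ * (D.card : ℝ) ^ (k ^ T)) :
    ∃ G ⊆ D, (D.card : ℝ) / 2 ≤ G.card ∧ (⋂ v ∈ G, C v).Nonempty := by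
  by_contra hcon
  push Not at hcon
  obtain ⟨N, hN, W, hWD, hWbad, hWdisj⟩ := greedy_blocks k hk0
    (fun s : Finset V => (⋂ v ∈ s, C v).Nonempty) D
    (by
      intro s hs
      obtain ⟨φ, hφ⟩ := ConvexitySpace.helly hR hk (fun v : s => C v) (fun v => hC v) (by
        rintro ⟨x, hx⟩
        apply hs
        refine ⟨x, ?_⟩
        simp only [Set.mem_iInter] at hx ⊢
        exact fun v hv => hx ⟨v, hv⟩)
      refine ⟨fun a => φ a, fun a => (φ a).2, ?_⟩
      rintro ⟨x, hx⟩
      apply hφ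
      refine ⟨x, ?_⟩
      simp only [Set.mem_iInter] at hx ⊢
      exact fun a => hx _ (Finset.mem_image.mpr ⟨a, Finset.mem_univ _, rfl⟩))
    (by
      intro G hG hc
      rw [hcon G hG hc]
      simp)
  have hs : ∀ u : Fin (k ^ T) → Fin N, ∃ s : Fin (k ^ T) → Fin k,
      ¬ (⋂ i, C (W (u i) (s i))).Nonempty := by
    intro u
    by_contra hall
    push Not at hall
    obtain ⟨i, x, hx⟩ := ConvexitySpace.colorful hT (fun i j => C (W (u i) j))
      (fun _ _ => hC _) hall
    apply hWbad (u i)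
    refine ⟨x, ?_⟩
    simp only [Set.mem_iInter] at hx ⊢
    intro v hv
    obtain ⟨a, _, rfl⟩ := Finset.mem_image.mp hv
    exact hx a
  choose s hs using hs
  have hcard : (Finset.univ : Finset (Fin (k ^ T) → Fin N)).card ≤
      (B.filter (fun w => ∀ j, w j ∈ D)).card := by
    apply Finset.card_le_card_of_injOn (fun u i => W (u i) (s u i))
    · intro u _
      exact Finset.mem_coe.mpr (Finset.mem_filter.mpr ⟨hB _ (hs u), fun j => hWD _ _⟩)
    · intro u _ u' _ h
      funext i
      exact hWdisj _ _ _ _ (congrFun h i)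
  have hD0' : (0 : ℝ) < D.card := by exact_mod_cast hD0.card_pos
  have hNpos : (0 : ℝ) < N := by
    rcases Nat.eq_zero_or_pos N with h | h
    · subst h
      simp at hN
      exact absurd hN hD0.ne_empty
    · exact_mod_cast h
  have h1 : (N : ℝ) ^ (k ^ T) ≤ δ * (D.card : ℝ) ^ (k ^ T) := by
    refine le_trans ?_ hBD
    have : (N : ℕ) ^ (k ^ T) ≤ (B.filter (fun w => ∀ j, w j ∈ D)).card := by
      simpa using hcard
    exact_mod_cast this
  have h2 : (D.card : ℝ) ^ (k ^ T) ≤ (2 * k * N) ^ (k ^ T) := by gcongr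
  have h3 : (N : ℝ) ^ (k ^ T) ≤ (δ * (2 * k) ^ (k ^ T)) * (N : ℝ) ^ (k ^ T) := by
    rw [mul_assoc, ← mul_pow]
    exact h1.trans (mul_le_mul_of_nonneg_left h2 hδ0)
  have h4 : (0 : ℝ) < (N : ℝ) ^ (k ^ T) := by positivity
  nlinarith

theorem choose_lower (n m : ℕ) (hm : 0 < m) (h : m ≤ n) :
    (n : ℝ) ^ m ≤ (m ^ m * m.factorial : ℝ) * (n.choose m : ℝ) := by
  have h1 : (n + 1 - m) ^ m ≤ m.factorial * n.choose m := by
    have := Nat.pow_le_choose (α := ℝ) m n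
    have hf : (0 : ℝ) < m.factorial := by exact_mod_cast m.factorial_pos
    rw [div_le_iff₀ hf, mul_comm] at this
    exact_mod_cast this
  have h2 : n ≤ m * (n + 1 - m) := by
    obtain ⟨d, rfl⟩ := Nat.exists_eq_add_of_le h
    rw [show m + d + 1 - m = d + 1 by omega]
    nlinarith
  have h3 : n ^ m ≤ m ^ m * (m.factorial * n.choose m) := by
    calc n ^ m ≤ (m * (n + 1 - m)) ^ m := Nat.pow_le_pow_left h2 m
      _ = m ^ m * (n + 1 - m) ^ m := mul_pow _ _ _
      _ ≤ _ := Nat.mul_le_mul_left _ h1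
  rw [mul_assoc]
  exact_mod_cast h3

/-- Number of intersecting subsets is at most number of intersecting tuples. -/
theorem subsets_le_tuples {X : Type*} (F : Finset (Set X)) (m : ℕ) :
    ((F.powersetCard m).filter (fun G => (⋂₀ (G : Set (Set X))).Nonempty)).card ≤
    (Finset.univ.filter (fun x : Fin m → F => (⋂ i, (x i : Set X)).Nonempty)).card := by
  apply Finset.card_le_card_of_surjOn (fun x => Set.range (fun i => (x i : Set X)))
  intro G' hG
  simp only [Finset.coe_filter, Finset.bind_def, Finset.pure_def, Finset.mem_sup,
    Finset.mem_singleton, Finset.mem_powersetCard, Set.mem_ofPred_eq] at hG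
  obtain ⟨⟨G, ⟨hGF, hc⟩, rfl⟩, hne⟩ := hG
  have e : Fin m ≃ G := (finCongr hc.symm).trans G.equivFin.symm
  refine ⟨fun i => ⟨e i, hGF (e i).2⟩, ?_, ?_⟩
  · simp only [Finset.coe_filter, Finset.mem_univ, true_and, Set.mem_ofPred_eq]
    obtain ⟨x, hx⟩ := hne
    exact ⟨x, Set.mem_iInter.mpr fun i => hx _ (e i).2⟩
  · ext S
    simp only [Set.mem_range, Finset.mem_coe]
    constructor
    · rintro ⟨i, rfl⟩
      exact (e i).2
    · intro hS
      exact ⟨e.symm ⟨S, hS⟩, by simp⟩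

/-- **Fractional Helly theorem for convexity spaces** (Theorem 1).
For every `r ≥ 3` there is an `m = m(r)`, and for every `α ∈ (0,1)` a `β = β(α,r) ∈ (0,1)`,
such that for every family `F` of `n ≥ m` convex sets in a convexity space with Radon number
at most `r`, if at least `α · (n choose m)` of the `m`-element subfamilies of `F` have
nonempty intersection, then some `β · n` members of `F` have a common point. -/
theorem fractional_helly_convexity_spaces (r : ℕ) (hr : 3 ≤ r) :
    ∃ m : ℕ, ∀ α : ℝ, 0 < α → α < 1 →
      ∃ β : ℝ, 0 < β ∧ β < 1 ∧
        ∀ (X : Type*) (_ : Nonempty X) (CS : ConvexitySpace X), CS.RadonLE r →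
          ∀ F : Finset (Set X), (∀ S ∈ F, S ∈ CS.sets) → m ≤ F.card →
            α * ((F.card.choose m : ℕ) : ℝ) ≤
              (((F.powersetCard m).filter
                (fun G => (⋂₀ (G : Set (Set X))).Nonempty)).card : ℝ) →
            ∃ G ⊆ F, β * (F.card : ℝ) ≤ (G.card : ℝ) ∧
              (⋂₀ (G : Set (Set X))).Nonempty := by
  have hk : r ≤ 2 ^ r := Nat.lt_two_pow_self.le
  have hk0 : 0 < 2 ^ r := by positivity
  obtain ⟨k, hkdef⟩ : ∃ k, k = 2 ^ r := ⟨_, rfl⟩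
  obtain ⟨T, hTdef⟩ : ∃ T, T = r ^ r := ⟨_, rfl⟩
  rw [← hkdef] at hk hk0
  obtain ⟨m, hmdef⟩ : ∃ m, m = k ^ T := ⟨_, rfl⟩
  have hm0 : 0 < m := by rw [hmdef]; positivity
  refine ⟨m, fun α hα _ => ?_⟩
  have hm0R : (0 : ℝ) < m := by exact_mod_cast hm0
  have hk0R : (0 : ℝ) < k := by exact_mod_cast hk0
  have hfac : (0 : ℝ) < m.factorial := by exact_mod_cast m.factorial_pos
  obtain ⟨δ, hδ0, hδ⟩ : ∃ δ : ℝ, 0 < δ ∧ δ * (2 * k) ^ (k ^ T) < 1 := by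
    refine ⟨1 / 2 / (2 * k) ^ (k ^ T), by positivity, ?_⟩
    rw [div_mul_cancel₀ _ (by positivity)]
    norm_num
  obtain ⟨α', hα', H⟩ := density_step m m δ hδ0 (α / (m ^ m * m.factorial)) (by positivity)
  refine ⟨min (α' / 2) (1 / 2), by positivity, (min_le_right _ _).trans_lt (by norm_num), ?_⟩
  intro X _ CS hR F hF hmF hcount
  have hT : CS.Tv (Fin T) (Fin k) := by
    rw [hTdef, hkdef]
    exact ConvexitySpace.tv_pow hR r
  have hFne : F.Nonempty := Finset.card_pos.mp (hm0.trans_le hmF)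
  have : Nonempty F := hFne.to_subtype
  have hFpos : (0 : ℝ) < F.card := by exact_mod_cast hFne.card_pos
  have hRc : α / (m ^ m * m.factorial) * (Fintype.card F : ℝ) ^ m ≤
      (Finset.univ.filter (fun x : Fin m → F => (⋂ i, (x i : Set X)).Nonempty)).card := by
    have h1 := choose_lower F.card m hm0 hmF
    have h2 : (((F.powersetCard m).filter
        (fun G => (⋂₀ (G : Set (Set X))).Nonempty)).card : ℝ) ≤
        (Finset.univ.filter (fun x : Fin m → F => (⋂ i, (x i : Set X)).Nonempty)).card := by
      exact_mod_cast subsets_le_tuples F m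
    refine le_trans ?_ (hcount.trans h2)
    rw [Fintype.card_coe, div_mul_eq_mul_div, div_le_iff₀ (by positivity), mul_assoc]
    refine mul_le_mul_of_nonneg_left ?_ hα.le
    rw [mul_comm]
    linarith
  rcases H F _ (Finset.univ.filter (fun x : Fin m → F => ¬ (⋂ i, (x i : Set X)).Nonempty)) hRc
    with ⟨D, hD1, hD2⟩ | ⟨W, hW1, hW2⟩
  · rw [Fintype.card_coe] at hD1
    have hD0 : D.Nonempty := by
      rw [← Finset.card_pos]
      have : (0 : ℝ) < D.card := lt_of_lt_of_le (by positivity) hD1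
      exact_mod_cast this
    subst hmdef
    obtain ⟨G, hGD, hG1, hG2⟩ := dense_case hR hk hk0 hT (fun v : F => (v : Set X))
      (fun v => hF v v.2) D hD0 δ hδ hδ0.le _ (fun x hx => by simpa using hx) hD2
    refine ⟨G.map (Function.Embedding.subtype _), ?_, ?_, ?_⟩
    · intro S hS
      obtain ⟨v, _, rfl⟩ := Finset.mem_map.mp hS
      exact v.2
    · rw [Finset.card_map]
      have := mul_le_mul_of_nonneg_right (min_le_left (α' / 2) (1 / 2)) hFpos.le
      linarith
    · obtain ⟨x, hx⟩ := hG2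
      refine ⟨x, ?_⟩
      intro S hS
      obtain ⟨v, hv, rfl⟩ := Finset.mem_map.mp (Finset.mem_coe.mp hS)
      simp only [Set.mem_iInter] at hx
      exact hx v hv
  · exfalso
    subst hmdef
    obtain ⟨i, hi⟩ := ConvexitySpace.colorful' hR hk hT (fun i j => (W i j : Set X))
      (fun i j => hF _ (W i j).2) (fun s => (Finset.mem_filter.mp (hW2 s)).2)
    exact (Finset.mem_filter.mp (hW1 i)).2 hi
end

section
/- For any integers m ≥ k > 1 and any α ∈ (0,1), there exists a constant β = β(α, k, m) ∈ (0,1) with the following property: let H = (V, E) be a k-uniform hypergraph on n vertices such that the number of cliques of H on m vertices is at least α·binom(n, m). If H does not contain a complete m-tuple of missing edges, then H has a clique on at least β·n vertices. -/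
open scoped Classical

/-- A subset `S` of the vertex set is a clique of the `k`-uniform hypergraph with edge set
`E`: every `k`-element subset of `S` is an edge. -/
def IsClique {V : Type*} (E : Finset (Finset V)) (k : ℕ) (S : Finset V) : Prop :=
  ∀ t ⊆ S, t.card = k → t ∈ E

/-- `τ : Fin m → Finset V` is a complete `m`-tuple of missing edges of the `k`-uniform
hypergraph with edge set `E`: the `τ i` are pairwise disjoint `k`-sets that are not edges,
and every transversal `{t₁, …, t_m}` with `t_i ∈ τ i` is a clique. -/
def CompleteMissingTuple {V : Type*} (E : Finset (Finset V)) (k m : ℕ)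
    (τ : Fin m → Finset V) : Prop :=
  (∀ i, (τ i).card = k ∧ τ i ∉ E) ∧
  (∀ i j, i ≠ j → Disjoint (τ i) (τ j)) ∧
  (∀ t : Fin m → V, (∀ i, t i ∈ τ i) → IsClique E k (Finset.univ.image t))

universe uu

/-- Ordered missing edges inside `W`. -/
noncomputable def missTuples {V : Type uu} [Fintype V] (E : Finset (Finset V)) (k : ℕ)
    (W : Finset V) : Finset (Fin k → V) :=
  Finset.univ.filter (fun g => Function.Injective g ∧ (∀ i, g i ∈ W) ∧
    Finset.univ.image g ∉ E)

/-- Greedy matching of missing edges. -/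
lemma exists_matching {V : Type uu} [Fintype V] (E : Finset (Finset V)) (k : ℕ)
    (hk : 0 < k) (W : Finset V) (hW : ∀ S ⊆ W, IsClique E k S → 2 * S.card ≤ W.card) :
    ∃ M : Finset (Finset V), (∀ e ∈ M, e.card = k ∧ e ∉ E ∧ e ⊆ W) ∧
      (∀ e ∈ M, ∀ f ∈ M, e ≠ f → Disjoint e f) ∧ W.card ≤ 2 * k * M.card := by
  let P : Finset (Finset (Finset V)) := Finset.univ.filter (fun M =>
    (∀ e ∈ M, e.card = k ∧ e ∉ E ∧ e ⊆ W) ∧ (∀ e ∈ M, ∀ f ∈ M, e ≠ f → Disjoint e f))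
  have hP : P.Nonempty := ⟨∅, by simp [P]⟩
  obtain ⟨M, hM, hmax⟩ := Finset.exists_max_image P Finset.card hP
  simp only [P, Finset.mem_filter, Finset.mem_univ, true_and] at hM hmax
  refine ⟨M, hM.1, hM.2, ?_⟩
  have hU : (M.biUnion id).card ≤ M.card * k :=
    Finset.card_biUnion_le_card_mul _ _ _ (fun e he => (hM.1 e he).1.le)
  have hcl : IsClique E k (W \ M.biUnion id) := by
    intro s hs hsk
    by_contra hsE
    have hdis : ∀ e ∈ M, Disjoint s e := by
      intro e he
      rw [Finset.disjoint_left]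
      intro a ha hae
      have := hs ha
      rw [Finset.mem_sdiff, Finset.mem_biUnion] at this
      exact this.2 ⟨e, he, hae⟩
    by_cases hsM : s ∈ M
    · have h0 := hdis s hsM
      have hs0 : s = ∅ := by simpa using h0
      rw [hs0, Finset.card_empty] at hsk
      omega
    · have := hmax (insert s M) ⟨?_, ?_⟩
      · rw [Finset.card_insert_of_notMem hsM] at this
        omega
      · intro e he
        rcases Finset.mem_insert.1 he with rfl | he
        · exact ⟨hsk, hsE, hs.trans Finset.sdiff_subset⟩
        · exact hM.1 e he
      · intro e he f hf hef
        rcases Finset.mem_insert.1 he with h1 | h1 <;> rcases Finset.mem_insert.1 hf with h2 | h2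
        · exact absurd (h1.trans h2.symm) hef
        · rw [h1]; exact hdis f h2
        · rw [h2]; exact (hdis e h1).symm
        · exact hM.2 e h1 f h2 hef
  have h1 := hW _ Finset.sdiff_subset hcl
  have h2 := Finset.le_card_sdiff (M.biUnion id) W
  have : 2 * k * M.card = 2 * (M.card * k) := by ring
  omega

/-- Tuples with two equal entries. -/
lemma card_eq_le {T : Type uu} [Fintype T] (m : ℕ) (i j : Fin m) (hij : i ≠ j) :
    (Finset.univ.filter (fun f : Fin m → T => f i = f j)).card ≤ Fintype.card T ^ (m - 1) := by
  have : Fintype.card ({a : Fin m // a ≠ j} → T) = Fintype.card T ^ (m - 1) := by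
    rw [Fintype.card_fun]; congr 1
    simp [Fintype.card_subtype_compl]
  rw [← this, ← Finset.card_univ]
  apply Finset.card_le_card_of_injOn (fun f a => f a.1) (by simp)
  intro f hf g hg hfg
  simp only [Finset.coe_filter, Finset.mem_univ, true_and, Set.mem_ofPred_eq] at hf hg
  have h : ∀ a, a ≠ j → f a = g a := fun a ha => congrFun hfg ⟨a, ha⟩
  funext a
  by_cases ha : a = j
  · subst ha; rw [← hf, ← hg]; exact h i hij
  · exact h a ha

/-- Tuples with a prescribed restriction. -/
lemma card_restrict_le {T : Type uu} [Fintype T] (k m : ℕ) (p : Fin k → Fin m)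
    (hp : Function.Injective p) (B : Finset (Fin k → T)) :
    (Finset.univ.filter (fun f : Fin m → T => f ∘ p ∈ B)).card
      ≤ B.card * Fintype.card T ^ (m - k) := by
  have : Fintype.card ({a : Fin m // ¬ a ∈ Set.range p} → T) = Fintype.card T ^ (m - k) := by
    rw [Fintype.card_fun]; congr 1
    rw [Fintype.card_subtype_compl]
    have : Fintype.card {x // x ∈ Set.range p} = k := by
      rw [← Fintype.card_congr (Equiv.ofInjective p hp), Fintype.card_fin]
    rw [this]; simp
  rw [← this, ← Finset.card_univ, ← Finset.card_product]
  apply Finset.card_le_card_of_injOn (fun f => (f ∘ p, fun a => f a.1))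
  · intro f hf
    simpa using hf
  intro f hf g hg hfg
  simp only [Prod.mk.injEq] at hfg
  funext a
  by_cases ha : a ∈ Set.range p
  · obtain ⟨b, rfl⟩ := ha
    exact congrFun hfg.1 b
  · exact congrFun hfg.2 ⟨a, ha⟩

lemma final_step (k m : ℕ) (hk : 1 < k) (hkm : k ≤ m) :
    ∃ ε : ℝ, 0 < ε ∧ ∃ T0 : ℕ, 0 < T0 ∧
      ∀ (V : Type uu) (_ : Fintype V) (E : Finset (Finset V)) (W : Finset V),
        T0 ≤ W.card → (∀ S ⊆ W, IsClique E k S → 2 * S.card ≤ W.card) →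
        ((missTuples E k W).card : ℝ) ≤ ε * (W.card : ℝ) ^ k →
        ∃ τ : Fin m → Finset V, CompleteMissingTuple E k m τ := by
  have hm0 : 0 < m := by omega
  refine ⟨1 / (4 * (m : ℝ) ^ k * (2 * k) ^ k), by positivity, 2 * k * (4 * m ^ 2), by positivity, ?_⟩
  intro V _ E W hT hW hmiss
  obtain ⟨M, hM, hdis, hcard⟩ := exists_matching E k (by omega) W hW
  have hMc : 4 * m ^ 2 ≤ M.card := by
    have := hT.trans hcard
    exact Nat.le_of_mul_le_mul_left this (by positivity)
  -- the block hypergraph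
  let B : Finset (Fin k → M) := Finset.univ.filter (fun b => Function.Injective b ∧
    ∃ g : Fin k → V, (∀ i, g i ∈ (b i).1) ∧ Finset.univ.image g ∉ E)
  have huniq : ∀ (a b : M) (v : V), v ∈ a.1 → v ∈ b.1 → a = b := by
    intro a b v ha hb
    by_contra hab
    have := hdis a.1 a.2 b.1 b.2 (fun h => hab (Subtype.ext h))
    exact (Finset.disjoint_left.1 this) ha hb
  have hB : B.card ≤ (missTuples E k W).card := by
    have hex : ∀ b ∈ B, Function.Injective b ∧ ∃ g : Fin k → V, (∀ i, g i ∈ (b i).1) ∧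
        Finset.univ.image g ∉ E := by
      intro b hb; simpa [B] using hb
    let G : (Fin k → M) → (Fin k → V) := fun b =>
      if h : b ∈ B then (hex b h).2.choose else fun i => (Finset.card_pos.1
        (by rw [(hM (b i).1 (b i).2).1]; omega) : (b i).1.Nonempty).choose
    have hG : ∀ b ∈ B, (∀ i, G b i ∈ (b i).1) ∧ Finset.univ.image (G b) ∉ E := by
      intro b hb
      simp only [G, dif_pos hb]
      exact (hex b hb).2.choose_spec
    apply Finset.card_le_card_of_injOn G
    · intro b hb
      have h := hG b hb
      simp only [missTuples, Finset.coe_filter, Finset.mem_univ, true_and, Set.mem_ofPred_eq]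
      refine ⟨?_, fun i => (hM _ (b i).2).2.2 (h.1 i), h.2⟩
      intro i j hij
      apply (hex b hb).1
      exact huniq _ _ _ (h.1 i) (hij ▸ h.1 j)
    · intro b hb b' hb' hbb
      funext i
      exact huniq _ _ _ ((hG b hb).1 i) (by rw [hbb]; exact (hG b' hb').1 i)
  -- counting
  set t := M.card with ht
  have htT : Fintype.card M = t := by simp [ht]
  let Bad1 : Finset (Fin m → M) := (Finset.univ.filter (fun q : Fin m × Fin m => q.1 ≠ q.2)).biUnion
    (fun q => Finset.univ.filter (fun f : Fin m → M => f q.1 = f q.2))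
  let Bad2 : Finset (Fin m → M) :=
    (Finset.univ.filter (fun p : Fin k → Fin m => Function.Injective p)).biUnion
    (fun p => Finset.univ.filter (fun f : Fin m → M => f ∘ p ∈ B))
  have hb1 : Bad1.card ≤ m ^ 2 * t ^ (m - 1) := by
    refine (Finset.card_biUnion_le_card_mul _ _ (t ^ (m - 1)) ?_).trans ?_
    · intro q hq
      rw [← htT]
      have hq' : q.1 ≠ q.2 := (Finset.mem_filter.1 hq).2
      convert card_eq_le (T := M) m q.1 q.2 hq'
    · apply Nat.mul_le_mul_right
      refine (Finset.card_le_univ _).trans ?_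
      simp [sq]
  have hb2 : Bad2.card ≤ m ^ k * (B.card * t ^ (m - k)) := by
    refine (Finset.card_biUnion_le_card_mul _ _ (B.card * t ^ (m - k)) ?_).trans ?_
    · intro p hp
      rw [← htT]
      have hp' : Function.Injective p := (Finset.mem_filter.1 hp).2
      convert card_restrict_le (T := M) k m p hp' B
    · apply Nat.mul_le_mul_right
      refine (Finset.card_le_univ _).trans ?_
      simp
  have ht0 : 0 < t := lt_of_lt_of_le (by positivity) hMc
  have htot : ((Bad1 ∪ Bad2).card : ℝ) < (t : ℝ) ^ m := by
    have h1 : ((Bad1 ∪ Bad2).card : ℝ) ≤ Bad1.card + Bad2.card := by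
      exact_mod_cast Finset.card_union_le _ _
    have h2 : (Bad1.card : ℝ) ≤ (t : ℝ) ^ m / 4 := by
      have e : (t : ℝ) ^ m = t * (t : ℝ) ^ (m - 1) := by
        rw [← pow_succ']; congr 1; omega
      have : (Bad1.card : ℝ) ≤ (m : ℝ) ^ 2 * t ^ (m - 1) := by exact_mod_cast hb1
      have h4 : 4 * (m : ℝ) ^ 2 ≤ t := by exact_mod_cast hMc
      have h5 : (0 : ℝ) ≤ (t : ℝ) ^ (m - 1) := by positivity
      rw [e]
      nlinarith
    have h3 : (Bad2.card : ℝ) ≤ (t : ℝ) ^ m / 4 := by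
      have e : (t : ℝ) ^ m = (t : ℝ) ^ k * (t : ℝ) ^ (m - k) := by
        rw [← pow_add]; congr 1; omega
      have h4 : (Bad2.card : ℝ) ≤ (m : ℝ) ^ k * (B.card * t ^ (m - k)) := by exact_mod_cast hb2
      have h5 : (B.card : ℝ) ≤ 1 / (4 * (m : ℝ) ^ k * (2 * k) ^ k) * (W.card : ℝ) ^ k :=
        le_trans (by exact_mod_cast hB) hmiss
      have h6 : (W.card : ℝ) ^ k ≤ (2 * k * t) ^ k := by
        gcongr; exact_mod_cast hcard
      have h7 : (B.card : ℝ) ≤ t ^ k / (4 * (m : ℝ) ^ k) := by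
        refine h5.trans ((mul_le_mul_of_nonneg_left h6 (by positivity)).trans ?_)
        rw [mul_pow (2 * (k : ℝ)) (t : ℝ)]
        apply le_of_eq
        have : (2 * (k : ℝ)) ^ k ≠ 0 := by positivity
        have : (m : ℝ) ^ k ≠ 0 := by positivity
        field_simp
      calc (Bad2.card : ℝ) ≤ (m : ℝ) ^ k * (B.card * t ^ (m - k)) := h4
        _ ≤ (m : ℝ) ^ k * (t ^ k / (4 * (m : ℝ) ^ k) * t ^ (m - k)) := by gcongr
        _ = (t : ℝ) ^ m / 4 := by
          rw [e]
          have : (m : ℝ) ^ k ≠ 0 := by positivity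
          field_simp
    have : (0 : ℝ) < (t : ℝ) ^ m := by positivity
    linarith
  have hex : ∃ f : Fin m → M, f ∉ Bad1 ∪ Bad2 := by
    by_contra hcon
    push Not at hcon
    have : Bad1 ∪ Bad2 = Finset.univ := Finset.eq_univ_iff_forall.2 hcon
    rw [this, Finset.card_univ, Fintype.card_fun, htT, Fintype.card_fin] at htot
    push_cast at htot
    exact lt_irrefl _ htot
  obtain ⟨f, hf⟩ := hex
  rw [Finset.mem_union, not_or] at hf
  have hinj : Function.Injective f := by
    intro i j hij
    by_contra hne
    apply hf.1
    simp only [Bad1, Finset.mem_biUnion, Finset.mem_filter, Finset.mem_univ, true_and]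
    exact ⟨(i, j), hne, hij⟩
  have hfB : ∀ p : Fin k → Fin m, Function.Injective p → f ∘ p ∉ B := by
    intro p hp hpB
    apply hf.2
    simp only [Bad2, Finset.mem_biUnion, Finset.mem_filter, Finset.mem_univ, true_and]
    exact ⟨p, hp, hpB⟩
  refine ⟨fun i => (f i).1, fun i => ⟨(hM _ (f i).2).1, (hM _ (f i).2).2.1⟩, ?_, ?_⟩
  · intro i j hij
    exact hdis _ (f i).2 _ (f j).2 (fun h => hij (hinj (Subtype.ext h)))
  · intro x hx s hs hsk
    by_contra hsE
    -- enumerate s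
    have hpre : ∀ v : s, ∃ i, x i = v.1 := by
      intro v
      simpa using hs v.2
    choose q hq using hpre
    let eq := s.equivFinOfCardEq hsk
    refine hfB (fun a => q (eq.symm a)) ?_ ?_
    · intro a b hab
      apply eq.symm.injective
      apply Subtype.ext
      rw [← hq, ← hq]
      exact congrArg x hab
    · simp only [B, Finset.mem_filter, Finset.mem_univ, true_and]
      refine ⟨?_, fun a => (eq.symm a).1, ?_, ?_⟩
      · intro a b hab
        apply eq.symm.injective
        apply Subtype.ext
        rw [← hq, ← hq]
        exact congrArg x (hinj hab)
      · intro a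
        have := hx (q (eq.symm a))
        rw [hq] at this
        exact this
      · have : Finset.univ.image (fun a => (eq.symm a).1) = s := by
          ext v
          simp only [Finset.mem_image, Finset.mem_univ, true_and]
          constructor
          · rintro ⟨a, rfl⟩; exact (eq.symm a).2
          · intro hv; exact ⟨eq ⟨v, hv⟩, by simp⟩
        rw [this]; exact hsE

set_option maxHeartbeats 2000000 in
lemma drc_step (k j : ℕ) (c ε : ℝ) (hc : 0 < c) (hε : 0 < ε) :
    ∃ c' : ℝ, 0 < c' ∧ ∀ (V : Type uu) (_ : Fintype V) (E : Finset (Finset V))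
      (F : Finset (Fin (j + 1) → V)), 0 < Fintype.card V →
      c * (Fintype.card V : ℝ) ^ (j + 1) ≤ F.card →
      (∃ g : Fin k → V, g ∈ missTuples E k Finset.univ ∧
        c' * (Fintype.card V : ℝ) ^ j ≤
          (Finset.univ.filter (fun x : Fin j → V => ∀ i, Fin.cons (g i) x ∈ F)).card) ∨
      ∃ W : Finset V, c / 2 * (Fintype.card V : ℝ) ≤ W.card ∧
        ((missTuples E k W).card : ℝ) ≤ ε * (W.card : ℝ) ^ k := by
  refine ⟨ε * (c / 2) ^ (k + 1) / 2, by positivity, ?_⟩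
  intro V _ E F hn hF
  set c' := ε * (c / 2) ^ (k + 1) / 2 with hc'
  set n : ℝ := (Fintype.card V : ℝ) with hnn
  have hn0 : 0 < n := by rw [hnn]; exact_mod_cast hn
  by_contra hcon
  push Not at hcon
  obtain ⟨h1, h2⟩ := hcon
  let Wx : (Fin j → V) → Finset V := fun x => Finset.univ.filter (fun v => Fin.cons v x ∈ F)
  have hFsum : (F.card : ℝ) = ∑ x : Fin j → V, ((Wx x).card : ℝ) := by
    have := Finset.card_eq_sum_card_fiberwise (s := F) (t := Finset.univ)
      (f := fun y => Fin.tail y) (by intro a _; simp)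
    rw [this]
    push_cast
    refine Finset.sum_congr rfl (fun x _ => ?_)
    congr 1
    symm
    apply Finset.card_bij (fun v _ => (Fin.cons v x : Fin (j + 1) → V))
    · intro v hv
      simpa [Wx] using hv
    · intro v _ w _ h
      have := congrFun h 0
      simpa using this
    · intro y hy
      simp only [Finset.mem_filter] at hy
      refine ⟨y 0, ?_, ?_⟩
      · simp only [Wx, Finset.mem_filter, Finset.mem_univ, true_and]
        rw [← hy.2, Fin.cons_self_tail]; exact hy.1
      · rw [← hy.2, Fin.cons_self_tail]
  have hsumN : ∑ x : Fin j → V, ((missTuples E k (Wx x)).card : ℝ) ≤ n ^ k * (c' * n ^ j) := by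
    have e1 : ∀ x, missTuples E k (Wx x) = (missTuples E k Finset.univ).filter
        (fun g => ∀ i, Fin.cons (g i) x ∈ F) := by
      intro x
      ext g
      simp only [missTuples, Wx, Finset.mem_filter, Finset.mem_univ, true_and, implies_true]
      tauto
    have e2 : ∑ x : Fin j → V, (missTuples E k (Wx x)).card
        = ∑ g ∈ missTuples E k Finset.univ,
          (Finset.univ.filter (fun x : Fin j → V => ∀ i, Fin.cons (g i) x ∈ F)).card := by
      simp only [e1]
      exact Finset.sum_card_bipartiteAbove_eq_sum_card_bipartiteBelow
        (s := (Finset.univ : Finset (Fin j → V))) (t := missTuples E k Finset.univ)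
        (fun x g => ∀ i, Fin.cons (g i) x ∈ F)
    have e3 : ∑ x : Fin j → V, ((missTuples E k (Wx x)).card : ℝ)
        = ∑ g ∈ missTuples E k Finset.univ,
          ((Finset.univ.filter (fun x : Fin j → V => ∀ i, Fin.cons (g i) x ∈ F)).card : ℝ) := by
      exact_mod_cast e2
    rw [e3]
    refine (Finset.sum_le_card_nsmul _ _ (c' * n ^ j) (fun g hg => (h1 g hg).le)).trans ?_
    rw [nsmul_eq_mul]
    have : ((missTuples E k (Finset.univ : Finset V)).card : ℝ) ≤ n ^ k := by
      have := Finset.card_le_univ (missTuples E k (Finset.univ : Finset V))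
      rw [Fintype.card_fun, Fintype.card_fin] at this
      rw [hnn]; exact_mod_cast this
    gcongr
  set D := ε * (c / 2) ^ k * n ^ k with hD
  have hD0 : 0 < D := by positivity
  have hpt : ∀ x, ((Wx x).card : ℝ) ≤ c / 2 * n + n / D * (missTuples E k (Wx x)).card := by
    intro x
    by_cases hx : c / 2 * n ≤ (Wx x).card
    · have h3 := h2 (Wx x) hx
      have h4 : D ≤ (missTuples E k (Wx x)).card := by
        refine le_trans ?_ h3.le
        rw [hD, mul_assoc, ← mul_pow]
        gcongr
      have h5 : ((Wx x).card : ℝ) ≤ n := by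
        rw [hnn]; exact_mod_cast Finset.card_le_univ (Wx x)
      have h6 : n ≤ n / D * (missTuples E k (Wx x)).card := by
        calc n = n / D * D := by field_simp
          _ ≤ _ := by gcongr
      have : 0 < c / 2 * n := by positivity
      linarith
    · have : 0 ≤ n / D * ((missTuples E k (Wx x)).card : ℝ) := by positivity
      linarith
  have hfin : (F.card : ℝ) ≤ c / 2 * n * n ^ j + n / D * (n ^ k * (c' * n ^ j)) := by
    rw [hFsum]
    refine (Finset.sum_le_sum (fun x _ => hpt x)).trans ?_
    rw [Finset.sum_add_distrib]
    have : ∑ _x : Fin j → V, c / 2 * n = c / 2 * n * n ^ j := by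
      rw [Finset.sum_const, Finset.card_univ, Fintype.card_fun, Fintype.card_fin, nsmul_eq_mul]
      push_cast
      ring
    rw [this, ← Finset.mul_sum]
    gcongr
  have e : n / D * (n ^ k * (c' * n ^ j)) = c / 4 * n ^ (j + 1) := by
    rw [hD, hc']
    have : (c / 2) ^ k ≠ 0 := by positivity
    field_simp
    ring
  rw [e] at hfin
  have hp : 0 < c * n ^ (j + 1) := by positivity
  have : c / 2 * n * n ^ j = c / 2 * n ^ (j + 1) := by ring
  nlinarith

lemma main_induction (k m : ℕ) (hk : 1 < k) (hkm : k ≤ m) (j : ℕ) : ∀ c : ℝ, 0 < c →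
    ∃ β : ℝ, 0 < β ∧ ∀ (V : Type uu) (_ : Fintype V) (E : Finset (Finset V))
      (F : Finset (Fin j → V)), 0 < Fintype.card V →
      c * (Fintype.card V : ℝ) ^ j ≤ F.card →
      (¬ ∃ τ : Fin m → Finset V, CompleteMissingTuple E k m τ) →
      (∃ S : Finset V, IsClique E k S ∧ β * (Fintype.card V : ℝ) ≤ (S.card : ℝ)) ∨
      ∃ τ : Fin j → Finset V, (∀ i, (τ i).card = k ∧ τ i ∉ E) ∧
        ∀ x : Fin j → V, (∀ i, x i ∈ τ i) → x ∈ F := by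
  induction j with
  | zero =>
    intro c hc
    refine ⟨1, one_pos, ?_⟩
    intro V _ E F _ hF _
    right
    refine ⟨fun _ => ∅, fun i => i.elim0, ?_⟩
    intro x _
    have : 0 < F.card := by
      have : (0 : ℝ) < F.card := lt_of_lt_of_le (by simpa using hc) hF
      exact_mod_cast this
    obtain ⟨y, hy⟩ := Finset.card_pos.1 this
    rwa [Subsingleton.elim x y]
  | succ j ih =>
    intro c hc
    obtain ⟨ε, hε, T0, hT0, hfinal⟩ := final_step.{uu} k m hk hkm
    obtain ⟨c', hc', hdrc⟩ := drc_step.{uu} k j c ε hc hε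
    obtain ⟨β₀, hβ₀, hih⟩ := ih c' hc'
    have hT0' : (0 : ℝ) < T0 := by exact_mod_cast hT0
    refine ⟨min β₀ (min (c / 4) (c / (2 * T0))), by positivity, ?_⟩
    intro V _ E F hn hF hno
    set n : ℝ := (Fintype.card V : ℝ) with hnn
    have hn0 : 0 < n := by rw [hnn]; exact_mod_cast hn
    rcases hdrc V _ E F hn hF with ⟨g, hg, hlink⟩ | ⟨W, hW, hmiss⟩
    · rcases hih V _ E _ hn hlink hno with ⟨S, hS, hSc⟩ | ⟨τ, hτ, hτF⟩
      · left
        refine ⟨S, hS, le_trans ?_ hSc⟩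
        gcongr
        exact min_le_left _ _
      · right
        simp only [missTuples, Finset.mem_filter, Finset.mem_univ, true_and] at hg
        refine ⟨Fin.cons (Finset.univ.image g) τ, ?_, ?_⟩
        · intro i
          refine Fin.cases ?_ ?_ i
          · simp only [Fin.cons_zero]
            refine ⟨?_, hg.2.2⟩
            rw [Finset.card_image_of_injective _ hg.1]; simp
          · intro i; simpa using hτ i
        · intro x hx
          have h0 := hx 0
          simp only [Fin.cons_zero, Finset.mem_image, Finset.mem_univ, true_and] at h0
          obtain ⟨a, ha⟩ := h0
          have := hτF (Fin.tail x) (fun i => by simpa [Fin.tail] using hx i.succ)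
          simp only [Finset.mem_filter, Finset.mem_univ, true_and] at this
          have := this a
          rwa [ha, Fin.cons_self_tail] at this
    · left
      by_cases hWT : T0 ≤ W.card
      · by_contra hcon
        push Not at hcon
        apply hno
        apply hfinal V _ E W hWT _ hmiss
        intro S _ hS
        have h1 := hcon S hS
        have h2 : min β₀ (min (c / 4) (c / (2 * T0))) * n ≤ c / 4 * n := by
          gcongr
          exact (min_le_right _ _).trans (min_le_left _ _)
        have : (2 * S.card : ℝ) ≤ W.card := by linarith
        exact_mod_cast this
      · obtain ⟨v⟩ := Fintype.card_pos_iff.1 hn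
        refine ⟨{v}, ?_, ?_⟩
        · intro s hs hsk
          have := Finset.card_le_card hs
          simp at this
          omega
        · have h1 : (W.card : ℝ) ≤ T0 := by exact_mod_cast (not_le.1 hWT).le
          have h2 : min β₀ (min (c / 4) (c / (2 * T0))) * n ≤ c / (2 * T0) * n := by
            gcongr
            exact (min_le_right _ _).trans (min_le_right _ _)
          refine h2.trans ?_
          simp only [Finset.card_singleton, Nat.cast_one]
          rw [div_mul_eq_mul_div, div_le_one (by positivity)]
          linarith

/-- **Cliques in dense uniform hypergraphs with no complete tuple of missing edges**
(Lemma 5, Theorem 1.2 of [holmsen-arx]). For all `m ≥ k > 1` and `α ∈ (0,1)` there is a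
`β = β(α,k,m) ∈ (0,1)` such that every `k`-uniform hypergraph on `n` vertices with at least
`α · (n choose m)` cliques on `m` vertices and no complete `m`-tuple of missing edges has a
clique on at least `β · n` vertices. -/
theorem clique_of_dense_hypergraph (k m : ℕ) (hk : 1 < k) (hkm : k ≤ m)
    (α : ℝ) (hα0 : 0 < α) (hα1 : α < 1) :
    ∃ β : ℝ, 0 < β ∧ β < 1 ∧
      ∀ (V : Type*) (_ : Fintype V) (E : Finset (Finset V)),
        (∀ e ∈ E, e.card = k) →
        α * (((Fintype.card V).choose m : ℕ) : ℝ) ≤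
          ((((Finset.univ : Finset V).powersetCard m).filter
            (fun S => IsClique E k S)).card : ℝ) →
        (¬ ∃ τ : Fin m → Finset V, CompleteMissingTuple E k m τ) →
        ∃ S : Finset V, IsClique E k S ∧ β * (Fintype.card V : ℝ) ≤ (S.card : ℝ) := by
  have hm0 : 0 < m := by omega
  obtain ⟨β₀, hβ₀, hmain⟩ := main_induction k m hk hkm m (α / (2 * m) ^ m) (by positivity)
  refine ⟨min β₀ (1 / (2 * m)), by positivity, ?_, ?_⟩
  · refine lt_of_le_of_lt (min_le_right _ _) ?_
    have : (1 : ℝ) ≤ m := by exact_mod_cast hm0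
    rw [div_lt_one (by positivity)]
    linarith
  intro V _ E hE hα hno
  have hsmall : (Fintype.card V : ℝ) ≤ 2 * m → ∃ S : Finset V, IsClique E k S ∧
      min β₀ (1 / (2 * m)) * (Fintype.card V : ℝ) ≤ (S.card : ℝ) := by
    intro hn
    rcases Nat.eq_zero_or_pos (Fintype.card V) with h0 | h0
    · refine ⟨∅, ?_, by simp [h0]⟩
      intro s hs hsk
      have := Finset.card_le_card hs
      simp at this
      subst this
      simp at hsk
      omega
    · obtain ⟨v⟩ := Fintype.card_pos_iff.1 h0
      refine ⟨{v}, ?_, ?_⟩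
      · intro s hs hsk
        have := Finset.card_le_card hs
        simp at this
        omega
      · have h2 : min β₀ (1 / (2 * (m : ℝ))) * (Fintype.card V : ℝ)
            ≤ 1 / (2 * m) * (Fintype.card V : ℝ) := by
          gcongr
          exact min_le_right _ _
        refine h2.trans ?_
        simp only [Finset.card_singleton, Nat.cast_one]
        rw [div_mul_eq_mul_div, div_le_one (by positivity)]
        linarith
  by_cases hn : (Fintype.card V : ℝ) ≤ 2 * m
  · exact hsmall hn
  have hn' : 2 * m < Fintype.card V := by
    rw [not_le] at hn; exact_mod_cast hn
  let F : Finset (Fin m → V) := Finset.univ.filter (fun f => Function.Injective f ∧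
    IsClique E k (Finset.univ.image f))
  have hFc : (((Finset.univ : Finset V).powersetCard m).filter
            (fun S => IsClique E k S)).card ≤ F.card := by
    apply Finset.card_le_card_of_surjOn (fun f => Finset.univ.image f)
    intro S hS
    simp only [Finset.coe_filter, Finset.mem_powersetCard_univ, Set.mem_ofPred_eq] at hS
    let eq := S.equivFinOfCardEq hS.1
    have him : Finset.univ.image (fun a => (eq.symm a).1) = S := by
      ext v
      simp only [Finset.mem_image, Finset.mem_univ, true_and]
      constructor
      · rintro ⟨a, rfl⟩; exact (eq.symm a).2
      · intro hv; exact ⟨eq ⟨v, hv⟩, by simp⟩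
    refine ⟨fun a => (eq.symm a).1, ?_, him⟩
    simp only [F, Finset.coe_filter, Finset.mem_univ, true_and, Set.mem_ofPred_eq]
    exact ⟨fun a b h => eq.symm.injective (Subtype.ext h), by rw [him]; exact hS.2⟩
  have hch : ((Fintype.card V : ℝ) / (2 * m)) ^ m ≤ ((Fintype.card V).choose m : ℝ) := by
    refine le_trans ?_ (Nat.pow_le_choose (α := ℝ) m (Fintype.card V))
    have e1 : (Fintype.card V : ℝ) / 2 ≤ ((Fintype.card V + 1 - m : ℕ) : ℝ) := by
      rw [div_le_iff₀ (by norm_num)]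
      have : Fintype.card V ≤ (Fintype.card V + 1 - m) * 2 := by omega
      exact_mod_cast this
    have e2 : ((m.factorial : ℕ) : ℝ) ≤ (m : ℝ) ^ m := by exact_mod_cast Nat.factorial_le_pow m
    have e3 : (0 : ℝ) < (m.factorial : ℕ) := by exact_mod_cast Nat.factorial_pos m
    rw [← div_div, div_pow]
    gcongr
  have hFlow : α / (2 * m) ^ m * (Fintype.card V : ℝ) ^ m ≤ F.card := by
    have h1 : (((((Finset.univ : Finset V).powersetCard m).filter
            (fun S => IsClique E k S)).card : ℕ) : ℝ) ≤ F.card := by exact_mod_cast hFc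
    refine le_trans ?_ (hα.trans h1)
    rw [div_mul_eq_mul_div, mul_div_assoc, ← div_pow]
    exact mul_le_mul_of_nonneg_left hch hα0.le
  rcases hmain V _ E F (by omega) hFlow hno with ⟨S, hS, hSc⟩ | ⟨τ, hτ, hτF⟩
  · refine ⟨S, hS, le_trans ?_ hSc⟩
    gcongr
    exact min_le_left _ _
  · exfalso
    apply hno
    refine ⟨τ, hτ, ?_, ?_⟩
    · intro i j hij
      rw [Finset.disjoint_left]
      intro v hvi hvj
      have hne : ∀ a, (τ a).Nonempty := fun a => Finset.card_pos.1 (by rw [(hτ a).1]; omega)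
      choose y hy using hne
      have hx := hτF (fun a => if a = i ∨ a = j then v else y a) (by
        intro a
        by_cases h1 : a = i
        · simpa [h1] using hvi
        · by_cases h2 : a = j
          · simpa [h2] using hvj
          · simpa [h1, h2] using hy a)
      simp only [F, Finset.mem_filter, Finset.mem_univ, true_and] at hx
      exact hij (hx.1 (by simp))
    · intro x hx
      have := hτF x hx
      simp only [F, Finset.mem_filter, Finset.mem_univ, true_and] at this
      exact this.2
end

section
/- (Bukh) For every integer k ≥ 3 there exists a convexity space (X, 𝒞) whose Radon number equals 4 and whose kth partition number satisfies r_k ≥ 3k − 1; that is, there is a multiset Y of elements of X of cardinality 3k − 2 (counting multiplicities) that admits no partition into k nonempty parts Y₁, …, Y_k with conv(Y₁) ∩ ⋯ ∩ conv(Y_k) ≠ ∅. In particular, the inequality r_k ≤ (k−1)(r₂−1)+1 fails in general for convexity spaces. -/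
open scoped Classical

namespace Bukh

/-- Matchings with at most two edges on `Fin n`. -/
abbrev New (n : ℕ) := {E : Finset (Finset (Fin n)) // E.card ≤ 2 ∧ (∀ e ∈ E, e.card = 2) ∧
  (∀ e ∈ E, ∀ f ∈ E, e ≠ f → Disjoint e f)}

/-- Points: base points and matchings. -/
abbrev Pt (n : ℕ) := Fin n ⊕ New n

/-- `F x S` says that `x` lies in the hull of the set `S` of base points. -/
def F {n : ℕ} : Pt n → Finset (Fin n) → Prop
  | Sum.inl a, S => a ∈ S
  | Sum.inr E, S => (∃ e ∈ E.1, e ⊆ S) ∨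
      (3 ≤ S.card ∧ (E.1.card ≤ 1 ∨ ∃ e ∈ E.1, ∃ v ∈ e, v ∈ S))

variable {n : ℕ}

lemma F_cases {E : New n} {S : Finset (Fin n)} (h : F (Sum.inr E) S) :
    S ∈ E.1 ∨ 3 ≤ S.card := by
  rcases h with ⟨e, he, hs⟩ | h
  · by_cases h3 : 3 ≤ S.card
    · exact Or.inr h3
    · left
      have : e = S := Finset.eq_of_subset_of_card_le hs (by rw [E.2.2.1 e he]; omega)
      exact this ▸ he
  · exact Or.inr h.1

lemma F_two {x : Pt n} {S : Finset (Fin n)} (h : F x S) : S.Nonempty := by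
  rcases x with a | E
  · exact ⟨a, h⟩
  · rcases F_cases h with h | h
    · rw [← Finset.card_pos, E.2.2.1 S h]; omega
    · rw [← Finset.card_pos]; omega

lemma F_edge {E : New n} {S e : Finset (Fin n)} (he : e ∈ E.1) (h : e ⊆ S) :
    F (Sum.inr E) S := Or.inl ⟨e, he, h⟩

lemma F_touch {E : New n} {S e : Finset (Fin n)} {a : Fin n} (he : e ∈ E.1) (hae : a ∈ e)
    (haS : a ∈ S) (h : S ∈ E.1 ∨ 3 ≤ S.card) : F (Sum.inr E) S := by
  rcases h with h | h
  · exact F_edge h subset_rfl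
  · exact Or.inr ⟨h, Or.inr ⟨e, he, a, hae, haS⟩⟩

/-- The convexity space. -/
noncomputable def CS (n : ℕ) : ConvexitySpace (Pt n) where
  sets := (Set.toFinite {A : Set (Pt n) | ∃ 𝒮 : Set (Finset (Fin n)),
    A = {x | ∀ S ∈ 𝒮, F x S}}).toFinset
  empty_mem := by
    simp only [Set.Finite.mem_toFinset, Set.mem_ofPred_eq]
    refine ⟨{∅}, ?_⟩
    ext x
    simp only [Set.mem_empty_iff_false, Set.mem_singleton_iff, forall_eq, Set.mem_ofPred_eq,
      false_iff]
    intro h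
    exact Finset.not_nonempty_empty (F_two h)
  univ_mem := by
    simp only [Set.Finite.mem_toFinset, Set.mem_ofPred_eq]
    exact ⟨∅, by ext x; simp⟩
  inter_mem := by
    simp only [Set.Finite.mem_toFinset, Set.mem_ofPred_eq]
    rintro _ ⟨𝒮, rfl⟩ _ ⟨𝒯, rfl⟩
    refine ⟨𝒮 ∪ 𝒯, ?_⟩
    ext x
    simp only [Set.mem_inter_iff, Set.mem_ofPred_eq, Set.mem_union]
    constructor
    · rintro ⟨h1, h2⟩ S (h | h)
      exacts [h1 S h, h2 S h]
    · intro h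
      exact ⟨fun S hS => h S (Or.inl hS), fun S hS => h S (Or.inr hS)⟩

lemma mem_hull {Y : Set (Pt n)} {z : Pt n} :
    z ∈ (CS n).hull Y ↔ ∀ S, (∀ x ∈ Y, F x S) → F z S := by
  unfold ConvexitySpace.hull
  simp only [CS, Set.Finite.mem_toFinset, Set.mem_sInter, Set.mem_ofPred_eq]
  constructor
  · intro h S hS
    exact h {x | ∀ T ∈ ({S} : Set (Finset (Fin n))), F x T}
      ⟨⟨{S}, rfl⟩, fun x hx => by simpa using hS x hx⟩ S rfl
  · rintro h A ⟨⟨𝒮, rfl⟩, hY⟩ S hS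
    exact h S fun x hx => hY hx S hS

/-- The Radon property of a finite set of points. -/
def Rad (P : Finset (Pt n)) : Prop :=
  ∃ P₁ P₂ : Finset (Pt n), P₁ ∪ P₂ = P ∧ Disjoint P₁ P₂ ∧
      ((CS n).hull ↑P₁ ∩ (CS n).hull ↑P₂).Nonempty

lemma rad_of {P : Finset (Pt n)} (A B : Finset (Pt n)) (hA : A ⊆ P) (hB : B ⊆ P)
    (hd : ∀ x ∈ A, x ∉ B) (z : Pt n) (h1 : ∀ S, (∀ x ∈ A, F x S) → F z S)
    (h2 : ∀ S, (∀ x ∈ B, F x S) → F z S) : Rad P := by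
  refine ⟨A, P \ A, Finset.union_sdiff_of_subset hA, Finset.disjoint_sdiff, z, ?_, ?_⟩
  · rw [mem_hull]
    intro S hS
    exact h1 S fun x hx => hS x (by simpa using hx)
  · rw [mem_hull]
    intro S hS
    refine h2 S fun x hx => hS x ?_
    have : x ∉ A := fun h => hd x h hx
    simpa using ⟨hB hx, this⟩

lemma rad22 {P : Finset (Pt n)} (x₁ x₂ x₃ x₄ : Pt n) (m₁ : x₁ ∈ P) (m₂ : x₂ ∈ P) (m₃ : x₃ ∈ P)
    (m₄ : x₄ ∈ P) (d13 : x₁ ≠ x₃) (d14 : x₁ ≠ x₄) (d23 : x₂ ≠ x₃) (d24 : x₂ ≠ x₄) (z : Pt n)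
    (h1 : ∀ S, F x₁ S → F x₂ S → F z S) (h2 : ∀ S, F x₃ S → F x₄ S → F z S) : Rad P := by
  refine rad_of {x₁, x₂} {x₃, x₄} ?_ ?_ ?_ z ?_ ?_
  · intro x; simp only [Finset.mem_insert, Finset.mem_singleton]; rintro (rfl | rfl) <;> assumption
  · intro x; simp only [Finset.mem_insert, Finset.mem_singleton]; rintro (rfl | rfl) <;> assumption
  · intro x; simp only [Finset.mem_insert, Finset.mem_singleton]; rintro (rfl | rfl) <;> tauto
  · intro S hS; exact h1 S (hS _ (by simp)) (hS _ (by simp))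
  · intro S hS; exact h2 S (hS _ (by simp)) (hS _ (by simp))

lemma rad13 {P : Finset (Pt n)} (x₁ x₂ x₃ x₄ : Pt n) (m₁ : x₁ ∈ P) (m₂ : x₂ ∈ P) (m₃ : x₃ ∈ P)
    (m₄ : x₄ ∈ P) (d12 : x₁ ≠ x₂) (d13 : x₁ ≠ x₃) (d14 : x₁ ≠ x₄)
    (h2 : ∀ S, F x₂ S → F x₃ S → F x₄ S → F x₁ S) : Rad P := by
  refine rad_of {x₁} {x₂, x₃, x₄} ?_ ?_ ?_ x₁ ?_ ?_
  · intro x; simp only [Finset.mem_singleton]; rintro rfl; assumption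
  · intro x; simp only [Finset.mem_insert, Finset.mem_singleton]
    rintro (rfl | rfl | rfl) <;> assumption
  · intro x; simp only [Finset.mem_insert, Finset.mem_singleton]; rintro rfl; tauto
  · intro S hS; exact hS _ (by simp)
  · intro S hS; exact h2 S (hS _ (by simp)) (hS _ (by simp)) (hS _ (by simp))

/-- At most one edge suffices for a common point. -/
lemma rad22_one {P : Finset (Pt n)} (x₁ x₂ x₃ x₄ : Pt n) (m₁ : x₁ ∈ P) (m₂ : x₂ ∈ P) (m₃ : x₃ ∈ P)
    (m₄ : x₄ ∈ P) (d13 : x₁ ≠ x₃) (d14 : x₁ ≠ x₄) (d23 : x₂ ≠ x₃) (d24 : x₂ ≠ x₄)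
    (T : Finset (Fin n) → Prop) (hT2 : ∀ e, T e → e.card = 2) (hT : ∀ e f, T e → T f → e = f)
    (h1 : ∀ S, F x₁ S → F x₂ S → (∃ e, T e ∧ e ⊆ S) ∨ 3 ≤ S.card)
    (h2 : ∀ S, F x₃ S → F x₄ S → (∃ e, T e ∧ e ⊆ S) ∨ 3 ≤ S.card) : Rad P := by
  by_cases hex : ∃ e, T e
  · obtain ⟨e, he⟩ := hex
    have key : ∀ S : Finset (Fin n), (∃ e, T e ∧ e ⊆ S) ∨ 3 ≤ S.card →
        F (Sum.inr ⟨{e}, by simp, by simpa using hT2 e he, by simp⟩) S := by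
      rintro S (⟨f, hf, hfS⟩ | h)
      · exact F_edge (e := e) (by simp) (hT f e hf he ▸ hfS)
      · exact Or.inr ⟨h, Or.inl (by simp)⟩
    exact rad22 x₁ x₂ x₃ x₄ m₁ m₂ m₃ m₄ d13 d14 d23 d24 _
      (fun S a b => key S (h1 S a b)) (fun S a b => key S (h2 S a b))
  · have key : ∀ S : Finset (Fin n), (∃ e, T e ∧ e ⊆ S) ∨ 3 ≤ S.card →
        F (Sum.inr ⟨∅, by simp, by simp, by simp⟩) S := by
      rintro S (⟨f, hf, hfS⟩ | h)
      · exact absurd ⟨f, hf⟩ hex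
      · exact Or.inr ⟨h, Or.inl (by simp)⟩
    exact rad22 x₁ x₂ x₃ x₄ m₁ m₂ m₃ m₄ d13 d14 d23 d24 _
      (fun S a b => key S (h1 S a b)) (fun S a b => key S (h2 S a b))

lemma three_eq (E : New n) {u v w : Finset (Fin n)} (hu : u ∈ E.1) (hv : v ∈ E.1) (hw : w ∈ E.1) :
    u = v ∨ u = w ∨ v = w := by
  by_contra! h
  have : 2 < E.1.card := Finset.two_lt_card.2 ⟨u, hu, v, hv, w, hw, h.1, h.2.1, h.2.2⟩
  have := E.2.1
  omega

lemma inter_one {E E' : New n} (hne : E ≠ E') {u v : Finset (Fin n)} (hu : u ∈ E.1) (hv : v ∈ E.1)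
    (hu' : u ∈ E'.1) (hv' : v ∈ E'.1) : u = v := by
  by_contra h
  apply hne
  apply Subtype.ext
  ext w
  constructor
  · intro hw
    rcases three_eq E hu hv hw with h' | h' | h'
    · exact absurd h' h
    · exact h' ▸ hu'
    · exact h' ▸ hv'
  · intro hw
    rcases three_eq E' hu' hv' hw with h' | h' | h'
    · exact absurd h' h
    · exact h' ▸ hu
    · exact h' ▸ hv

lemma at_one (E : New n) {u v : Finset (Fin n)} {a : Fin n} (hu : u ∈ E.1) (hv : v ∈ E.1)
    (ha : a ∈ u) (ha' : a ∈ v) : u = v := by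
  by_contra h
  exact Finset.disjoint_left.1 (E.2.2.2 u hu v hv h) ha ha'

lemma pair_eq {e : Finset (Fin n)} {a b : Fin n} (h : e.card = 2) (ha : a ∈ e) (hb : b ∈ e)
    (hab : a ≠ b) : e = {a, b} := by
  symm
  apply Finset.eq_of_subset_of_card_le
  · intro x; simp only [Finset.mem_insert, Finset.mem_singleton]; rintro (rfl | rfl) <;> assumption
  · rw [h, Finset.card_pair hab]

lemma rad40 {P : Finset (Pt n)} {a b c d : Fin n} (ma : Sum.inl a ∈ P) (mb : Sum.inl b ∈ P)
    (mc : Sum.inl c ∈ P) (md : Sum.inl d ∈ P) (hab : a ≠ b) (hac : a ≠ c) (had : a ≠ d)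
    (hbc : b ≠ c) (hbd : b ≠ d) (hcd : c ≠ d) : Rad P := by
  have hdis : Disjoint ({a, b} : Finset (Fin n)) {c, d} := by
    rw [Finset.disjoint_left]; intro x; simp only [Finset.mem_insert, Finset.mem_singleton]
    rintro (rfl | rfl) <;> tauto
  refine rad22 (Sum.inl a) (Sum.inl b) (Sum.inl c) (Sum.inl d) ma mb mc md (by simpa) (by simpa)
    (by simpa) (by simpa) (Sum.inr ⟨{{a, b}, {c, d}}, Finset.card_le_two, ?_, ?_⟩) ?_ ?_
  · intro e; simp only [Finset.mem_insert, Finset.mem_singleton]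
    rintro (rfl | rfl)
    exacts [Finset.card_pair hab, Finset.card_pair hcd]
  · intro e he f hf
    simp only [Finset.mem_insert, Finset.mem_singleton] at he hf
    rcases he with rfl | rfl <;> rcases hf with rfl | rfl
    · simp
    · intro _; exact hdis
    · intro _; exact hdis.symm
    · simp
  · intro S (h1 : a ∈ S) (h2 : b ∈ S)
    refine F_edge (e := {a, b}) (by simp) ?_
    intro x; simp only [Finset.mem_insert, Finset.mem_singleton]; rintro (rfl | rfl) <;> assumption
  · intro S (h1 : c ∈ S) (h2 : d ∈ S)
    refine F_edge (e := {c, d}) (by simp) ?_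
    intro x; simp only [Finset.mem_insert, Finset.mem_singleton]; rintro (rfl | rfl) <;> assumption

lemma pair_sub {S : Finset (Fin n)} {a b : Fin n} (h1 : a ∈ S) (h2 : b ∈ S) :
    ({a, b} : Finset (Fin n)) ⊆ S := by
  intro x; simp only [Finset.mem_insert, Finset.mem_singleton]; rintro (rfl | rfl) <;> assumption

lemma rad31_out {P : Finset (Pt n)} {a b c : Fin n} {E : New n} (ma : Sum.inl a ∈ P)
    (mb : Sum.inl b ∈ P) (mc : Sum.inl c ∈ P) (mE : Sum.inr E ∈ P) (hab : a ≠ b) (hac : a ≠ c)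
    (hbc : b ≠ c) (h : ∀ e ∈ E.1, a ∉ e) : Rad P := by
  refine rad22_one (Sum.inl a) (Sum.inr E) (Sum.inl b) (Sum.inl c) ma mE mb mc (by simpa) (by simpa)
    (by simp) (by simp) (fun e => e = {b, c}) ?_ ?_ ?_ ?_
  · rintro e rfl; exact Finset.card_pair hbc
  · rintro e f rfl rfl; rfl
  · intro S (h1 : a ∈ S) h2
    rcases F_cases h2 with h2 | h2
    · exact absurd h1 (h S h2)
    · exact Or.inr h2
  · intro S (h1 : b ∈ S) (h2 : c ∈ S)
    exact Or.inl ⟨_, rfl, pair_sub h1 h2⟩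

lemma rad31_in {P : Finset (Pt n)} {a b c : Fin n} {E : New n} (ma : Sum.inl a ∈ P)
    (mb : Sum.inl b ∈ P) (mc : Sum.inl c ∈ P) (mE : Sum.inr E ∈ P) (hab : a ≠ b) (hac : a ≠ c)
    (hbc : b ≠ c) {e : Finset (Fin n)} (he : e ∈ E.1) (hae : a ∈ e) (hbe : b ∈ e) : Rad P := by
  refine rad22 (Sum.inl c) (Sum.inr E) (Sum.inl a) (Sum.inl b) mc mE ma mb (by simpa using hac.symm)
    (by simpa using hbc.symm) (by simp) (by simp) (Sum.inr E) (fun S _ h => h) ?_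
  intro S (h1 : a ∈ S) (h2 : b ∈ S)
  refine F_edge he ?_
  rw [pair_eq (E.2.2.1 e he) hae hbe hab]
  exact pair_sub h1 h2

lemma rad31 {P : Finset (Pt n)} {a b c : Fin n} {E : New n} (ma : Sum.inl a ∈ P)
    (mb : Sum.inl b ∈ P) (mc : Sum.inl c ∈ P) (mE : Sum.inr E ∈ P) (hab : a ≠ b) (hac : a ≠ c)
    (hbc : b ≠ c) : Rad P := by
  by_cases ha : ∀ e ∈ E.1, a ∉ e
  · exact rad31_out ma mb mc mE hab hac hbc ha
  by_cases hb : ∀ e ∈ E.1, b ∉ e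
  · exact rad31_out mb ma mc mE hab.symm hbc hac hb
  by_cases hc : ∀ e ∈ E.1, c ∉ e
  · exact rad31_out mc ma mb mE hac.symm hbc.symm hab hc
  push Not at ha hb hc
  obtain ⟨u, hu, hau⟩ := ha
  obtain ⟨v, hv, hbv⟩ := hb
  obtain ⟨w, hw, hcw⟩ := hc
  rcases three_eq E hu hv hw with h | h | h
  · subst h; exact rad31_in ma mb mc mE hab hac hbc hu hau hbv
  · subst h; exact rad31_in ma mc mb mE hac hab hbc.symm hu hau hcw
  · subst h; exact rad31_in mb mc ma mE hbc hab.symm hac.symm hv hbv hcw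

/-- The split `a, E | b, E'`, unless bad. -/
lemma rad22_split {P : Finset (Pt n)} {a b : Fin n} {E E' : New n} (ma : Sum.inl a ∈ P)
    (mb : Sum.inl b ∈ P) (mE : Sum.inr E ∈ P) (mE' : Sum.inr E' ∈ P) (hab : a ≠ b) (hE : E ≠ E') :
    Rad P ∨ ∃ f ∈ E.1, ∃ g ∈ E'.1, a ∈ f ∧ b ∈ g ∧ f ≠ g ∧ ¬ Disjoint f g := by
  by_cases hbad : ∃ f ∈ E.1, ∃ g ∈ E'.1, a ∈ f ∧ b ∈ g ∧ f ≠ g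
  · obtain ⟨f, hf, g, hg, haf, hbg, hfg⟩ := hbad
    by_cases hd : Disjoint f g
    · left
      refine rad22 (Sum.inl a) (Sum.inr E) (Sum.inl b) (Sum.inr E') ma mE mb mE' (by simpa)
        (by simp) (by simp) (by simpa) (Sum.inr ⟨{f, g}, Finset.card_le_two, ?_, ?_⟩) ?_ ?_
      · intro e; simp only [Finset.mem_insert, Finset.mem_singleton]
        rintro (rfl | rfl)
        exacts [E.2.2.1 _ hf, E'.2.2.1 _ hg]
      · intro e he f hf
        simp only [Finset.mem_insert, Finset.mem_singleton] at he hf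
        rcases he with rfl | rfl <;> rcases hf with rfl | rfl
        · simp
        · intro _; exact hd
        · intro _; exact hd.symm
        · simp
      · intro S (h1 : a ∈ S) h2
        refine F_touch (e := f) (by simp) haf h1 ?_
        rcases F_cases h2 with h2 | h2
        · left; simp [at_one E h2 hf h1 haf]
        · exact Or.inr h2
      · intro S (h1 : b ∈ S) h2
        refine F_touch (e := g) (by simp) hbg h1 ?_
        rcases F_cases h2 with h2 | h2
        · left; simp [at_one E' h2 hg h1 hbg]
        · exact Or.inr h2
    · exact Or.inr ⟨f, hf, g, hg, haf, hbg, hfg, hd⟩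
  · left
    push Not at hbad
    refine rad22_one (Sum.inl a) (Sum.inr E) (Sum.inl b) (Sum.inr E') ma mE mb mE' (by simpa)
        (by simp) (by simp) (by simpa) (fun e => (e ∈ E.1 ∧ a ∈ e) ∨ (e ∈ E'.1 ∧ b ∈ e)) ?_ ?_ ?_ ?_
    · rintro e (h | h)
      exacts [E.2.2.1 _ h.1, E'.2.2.1 _ h.1]
    · rintro e f (⟨h1, h2⟩ | ⟨h1, h2⟩) (⟨h3, h4⟩ | ⟨h3, h4⟩)
      · exact at_one E h1 h3 h2 h4
      · exact hbad e h1 f h3 h2 h4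
      · exact (hbad f h3 e h1 h4 h2).symm
      · exact at_one E' h1 h3 h2 h4
    · intro S (h1 : a ∈ S) h2
      rcases F_cases h2 with h2 | h2
      · exact Or.inl ⟨S, Or.inl ⟨h2, h1⟩, subset_rfl⟩
      · exact Or.inr h2
    · intro S (h1 : b ∈ S) h2
      rcases F_cases h2 with h2 | h2
      · exact Or.inl ⟨S, Or.inr ⟨h2, h1⟩, subset_rfl⟩
      · exact Or.inr h2

lemma rad2n2 {P : Finset (Pt n)} {a b : Fin n} {E E' : New n} (ma : Sum.inl a ∈ P)
    (mb : Sum.inl b ∈ P) (mE : Sum.inr E ∈ P) (mE' : Sum.inr E' ∈ P) (hab : a ≠ b) (hE : E ≠ E') :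
    Rad P := by
  by_cases hc : ∃ e ∈ E.1, e ∈ E'.1 ∧ e ≠ {a, b}
  · obtain ⟨e, he, he', heab⟩ := hc
    rcases rad22_split ma mb mE mE' hab hE with h | ⟨f, hf, g, hg, haf, hbg, hfg, hd⟩
    · exact h
    rcases rad22_split mb ma mE mE' hab.symm hE with h | ⟨f', hf', g', hg', hbf, hag, hfg', hd'⟩
    · exact h
    exfalso
    have hef : e = {a, b} ∨ a ∉ e ∨ b ∉ e := by
      by_contra! h
      exact h.1 (pair_eq (E.2.2.1 e he) h.2.1 h.2.2 hab)
    have e1 := three_eq E he hf hf'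
    have e2 := three_eq E' he' hg hg'
    have p1 := fun h => pair_eq (E.2.2.1 f hf) haf h hab
    have p2 := fun h => pair_eq (E'.2.2.1 g hg) h hbg hab
    have p3 := fun h => pair_eq (E.2.2.1 f' hf') h hbf hab
    have p4 := fun h => pair_eq (E'.2.2.1 g' hg') hag h hab
    have d1 := E.2.2.2 
    have d2 := E'.2.2.2
    grind
  · push Not at hc
    refine rad22_one (Sum.inl a) (Sum.inl b) (Sum.inr E) (Sum.inr E') ma mb mE mE' (by simp)
      (by simp) (by simp) (by simp) (fun e => e = {a, b}) ?_ ?_ ?_ ?_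
    · rintro e rfl; exact Finset.card_pair hab
    · rintro e f rfl rfl; rfl
    · intro S (h1 : a ∈ S) (h2 : b ∈ S)
      exact Or.inl ⟨_, rfl, pair_sub h1 h2⟩
    · intro S h1 h2
      rcases F_cases h1 with h1 | h1
      · rcases F_cases h2 with h2 | h2
        · exact Or.inl ⟨S, hc S h1 h2, subset_rfl⟩
        · exact Or.inr h2
      · exact Or.inr h1

lemma rad13_split {P : Finset (Pt n)} {a : Fin n} {x y w : New n} (ma : Sum.inl a ∈ P)
    (mx : Sum.inr x ∈ P) (my : Sum.inr y ∈ P) (mw : Sum.inr w ∈ P) (hxy : x ≠ y) (hxw : x ≠ w)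
    (hyw : y ≠ w) :
    Rad P ∨ ∃ f ∈ x.1, ∃ g ∈ y.1, g ∈ w.1 ∧ a ∈ f ∧ a ∈ g ∧ f ≠ g := by
  by_cases hbad : ∃ f ∈ x.1, ∃ g ∈ y.1, g ∈ w.1 ∧ a ∈ f ∧ f ≠ g
  · obtain ⟨f, hf, g, hg, hg', haf, hfg⟩ := hbad
    by_cases hag : a ∈ g
    · exact Or.inr ⟨f, hf, g, hg, hg', haf, hag, hfg⟩
    left
    refine rad13 (Sum.inr x) (Sum.inl a) (Sum.inr y) (Sum.inr w) mx ma my mw (by simp) (by simpa)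
      (by simpa) ?_
    intro S (h1 : a ∈ S) h2 h3
    refine F_touch hf haf h1 (Or.inr ?_)
    rcases F_cases h2 with h2 | h2
    · rcases F_cases h3 with h3 | h3
      · exact absurd (inter_one hyw h2 hg h3 hg' ▸ h1) hag
      · exact h3
    · exact h2
  · left
    push Not at hbad
    refine rad22_one (Sum.inl a) (Sum.inr x) (Sum.inr y) (Sum.inr w) ma mx my mw (by simp)
      (by simp) (by simpa) (by simpa) (fun e => (e ∈ x.1 ∧ a ∈ e) ∨ (e ∈ y.1 ∧ e ∈ w.1)) ?_ ?_ ?_ ?_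
    · rintro e (h | h)
      exacts [x.2.2.1 _ h.1, y.2.2.1 _ h.1]
    · rintro e f (⟨h1, h2⟩ | ⟨h1, h2⟩) (⟨h3, h4⟩ | ⟨h3, h4⟩)
      · exact at_one x h1 h3 h2 h4
      · exact hbad e h1 f h3 h4 h2
      · exact (hbad f h3 e h1 h2 h4).symm
      · exact inter_one hyw h1 h3 h2 h4
    · intro S (h1 : a ∈ S) h2
      rcases F_cases h2 with h2 | h2
      · exact Or.inl ⟨S, Or.inl ⟨h2, h1⟩, subset_rfl⟩
      · exact Or.inr h2
    · intro S h1 h2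
      rcases F_cases h1 with h1 | h1
      · rcases F_cases h2 with h2 | h2
        · exact Or.inl ⟨S, Or.inr ⟨h1, h2⟩, subset_rfl⟩
        · exact Or.inr h2
      · exact Or.inr h1

lemma rad1n3 {P : Finset (Pt n)} {a : Fin n} {x y w : New n} (ma : Sum.inl a ∈ P)
    (mx : Sum.inr x ∈ P) (my : Sum.inr y ∈ P) (mw : Sum.inr w ∈ P) (hxy : x ≠ y) (hxw : x ≠ w)
    (hyw : y ≠ w) : Rad P := by
  rcases rad13_split ma mx my mw hxy hxw hyw with h | ⟨f, hf, g, hg, hg', haf, hag, hfg⟩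
  · exact h
  rcases rad13_split ma my mx mw hxy.symm hyw hxw with
    h | ⟨f', hf', g', hgx, hgw, haf', hag', hfg'⟩
  · exact h
  exact absurd ((at_one x hf hgx haf hag').trans (at_one w hgw hg' hag' hag)) hfg

lemma rad04_split {P : Finset (Pt n)} {x y u v : New n} (mx : Sum.inr x ∈ P)
    (my : Sum.inr y ∈ P) (mu : Sum.inr u ∈ P) (mv : Sum.inr v ∈ P) (hxy : x ≠ y) (hxu : x ≠ u)
    (hxv : x ≠ v) (hyu : y ≠ u) (hyv : y ≠ v) (huv : u ≠ v) :
    Rad P ∨ ∃ f ∈ x.1, f ∈ y.1 ∧ ∃ g ∈ u.1, g ∈ v.1 ∧ f ≠ g := by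
  by_cases hbad : ∃ f ∈ x.1, f ∈ y.1 ∧ ∃ g ∈ u.1, g ∈ v.1 ∧ f ≠ g
  · exact Or.inr hbad
  · left
    push Not at hbad
    refine rad22_one (Sum.inr x) (Sum.inr y) (Sum.inr u) (Sum.inr v) mx my mu mv (by simpa)
      (by simpa) (by simpa) (by simpa)
      (fun e => (e ∈ x.1 ∧ e ∈ y.1) ∨ (e ∈ u.1 ∧ e ∈ v.1)) ?_ ?_ ?_ ?_
    · rintro e (h | h)
      exacts [x.2.2.1 _ h.1, u.2.2.1 _ h.1]
    · rintro e f (⟨h1, h2⟩ | ⟨h1, h2⟩) (⟨h3, h4⟩ | ⟨h3, h4⟩)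
      · exact inter_one hxy h1 h3 h2 h4
      · exact hbad e h1 h2 f h3 h4
      · exact (hbad f h3 h4 e h1 h2).symm
      · exact inter_one huv h1 h3 h2 h4
    · intro S h1 h2
      rcases F_cases h1 with h1 | h1
      · rcases F_cases h2 with h2 | h2
        · exact Or.inl ⟨S, Or.inl ⟨h1, h2⟩, subset_rfl⟩
        · exact Or.inr h2
      · exact Or.inr h1
    · intro S h1 h2
      rcases F_cases h1 with h1 | h1
      · rcases F_cases h2 with h2 | h2
        · exact Or.inl ⟨S, Or.inr ⟨h1, h2⟩, subset_rfl⟩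
        · exact Or.inr h2
      · exact Or.inr h1

lemma rad04 {P : Finset (Pt n)} {x y u v : New n} (mx : Sum.inr x ∈ P)
    (my : Sum.inr y ∈ P) (mu : Sum.inr u ∈ P) (mv : Sum.inr v ∈ P) (hxy : x ≠ y) (hxu : x ≠ u)
    (hxv : x ≠ v) (hyu : y ≠ u) (hyv : y ≠ v) (huv : u ≠ v) : Rad P := by
  rcases rad04_split mx my mu mv hxy hxu hxv hyu hyv huv with h | ⟨p, p1, p2, q, q3, q4, hpq⟩
  · exact h
  rcases rad04_split mx mu my mv hxu hxy hxv hyu.symm huv hyv with h | ⟨r, r1, r3, s, s2, s4, hrs⟩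
  · exact h
  rcases rad04_split mx mv my mu hxv hxy hxu hyv.symm huv.symm hyu with
    h | ⟨t, t1, t4, z, z2, z3, htz⟩
  · exact h
  exfalso
  have a1 := three_eq x p1 r1 t1
  have a2 := three_eq y p2 s2 z2
  have a3 := three_eq u q3 r3 z3
  have a4 := three_eq v q4 s4 t4
  have b1 := @inter_one _ _ _ hxy
  have b2 := @inter_one _ _ _ hxu
  have b3 := @inter_one _ _ _ hxv
  have b4 := @inter_one _ _ _ hyu
  have b5 := @inter_one _ _ _ hyv
  have b6 := @inter_one _ _ _ huv
  grind

lemma four_of_card {α : Type*} {s : Finset α} (h : 4 ≤ s.card) :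
    ∃ a ∈ s, ∃ b ∈ s, ∃ c ∈ s, ∃ d ∈ s, a ≠ b ∧ a ≠ c ∧ a ≠ d ∧ b ≠ c ∧ b ≠ d ∧ c ≠ d := by
  obtain ⟨a, ha⟩ : s.Nonempty := Finset.card_pos.1 (by omega)
  have : 2 < (s.erase a).card := by rw [Finset.card_erase_of_mem ha]; omega
  obtain ⟨b, hb, c, hc, d, hd, h1, h2, h3⟩ := Finset.two_lt_card.1 this
  simp only [Finset.mem_erase] at hb hc hd
  exact ⟨a, ha, b, hb.2, c, hc.2, d, hd.2, hb.1.symm, hc.1.symm, hd.1.symm, h1, h2, h3⟩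

lemma radon4 : (CS n).RadonLE 4 := by
  intro P hP
  suffices hR : Rad P by
    obtain ⟨P₁, P₂, h, h'⟩ := hR
    exact ⟨P₁, P₂, by rw [← h]; ext x; simp only [Finset.mem_union], h'⟩
  have hcard : P.toLeft.card + P.toRight.card = P.card := Finset.card_toLeft_add_card_toRight
  by_cases h4 : 4 ≤ P.toLeft.card
  · obtain ⟨a, ha, b, hb, c, hc, d, hd, h1, h2, h3, h4, h5, h6⟩ := four_of_card h4
    simp only [Finset.mem_toLeft] at ha hb hc hd
    exact rad40 ha hb hc hd h1 h2 h3 h4 h5 h6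
  by_cases h3 : 2 < P.toLeft.card
  · obtain ⟨a, ha, b, hb, c, hc, h1, h2, h3⟩ := Finset.two_lt_card.1 h3
    obtain ⟨x, hx⟩ : P.toRight.Nonempty := Finset.card_pos.1 (by omega)
    simp only [Finset.mem_toLeft, Finset.mem_toRight] at ha hb hc hx
    exact rad31 ha hb hc hx h1 h2 h3
  by_cases h2 : 1 < P.toLeft.card
  · obtain ⟨a, ha, b, hb, h1⟩ := Finset.one_lt_card.1 h2
    obtain ⟨x, hx, y, hy, h2⟩ := Finset.one_lt_card.1 (show 1 < P.toRight.card by omega)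
    simp only [Finset.mem_toLeft, Finset.mem_toRight] at ha hb hx hy
    exact rad2n2 ha hb hx hy h1 h2
  by_cases h1 : 0 < P.toLeft.card
  · obtain ⟨a, ha⟩ := Finset.card_pos.1 h1
    obtain ⟨x, hx, y, hy, z, hz, h1, h2, h3⟩ :=
      Finset.two_lt_card.1 (show 2 < P.toRight.card by omega)
    simp only [Finset.mem_toLeft, Finset.mem_toRight] at ha hx hy hz
    exact rad1n3 ha hx hy hz h1 h2 h3
  · obtain ⟨a, ha, b, hb, c, hc, d, hd, h1, h2, h3, h4, h5, h6⟩ :=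
      four_of_card (show 4 ≤ P.toRight.card by omega)
    simp only [Finset.mem_toRight] at ha hb hc hd
    exact rad04 ha hb hc hd h1 h2 h3 h4 h5 h6

/-- The base points seen in a set of points. -/
noncomputable def base (Y : Set (Pt n)) : Finset (Fin n) :=
  Finset.univ.filter fun v => Sum.inl v ∈ Y

lemma F_base {Y : Set (Pt n)} (hY : ∀ x ∈ Y, ∃ v : Fin n, x = Sum.inl v) {z : Pt n}
    (hz : z ∈ (CS n).hull Y) : F z (base Y) := by
  rw [mem_hull] at hz
  apply hz
  intro x hx
  obtain ⟨v, rfl⟩ := hY x hx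
  change v ∈ base Y
  simpa [base] using hx

lemma not_radon3 (hn : 3 ≤ n) : ¬ (CS n).RadonLE 3 := by
  intro h
  let a : Fin n := ⟨0, by omega⟩
  let b : Fin n := ⟨1, by omega⟩
  let c : Fin n := ⟨2, by omega⟩
  have hab : a ≠ b := by simp [a, b]
  have hac : a ≠ c := by simp [a, c]
  have hbc : b ≠ c := by simp [b, c]
  let Q : Finset (Fin n) := {a, b, c}
  have hQ : Q.card = 3 := Finset.card_eq_three.2 ⟨a, b, c, hab, hac, hbc, rfl⟩
  obtain ⟨P₁, P₂, hU, hD, z, hz1, hz2⟩ := h (Q.map ⟨Sum.inl, Sum.inl_injective⟩) (by simp [hQ])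
  have hin : ∀ x, x ∈ P₁ ∨ x ∈ P₂ → ∃ v ∈ Q, x = Sum.inl v := by
    intro x hx
    have hx : x ∈ Q.map ⟨Sum.inl, Sum.inl_injective⟩ := by
      rw [← hU]; exact (@Finset.mem_union _ (_) _ _ _).2 hx
    rw [Finset.mem_map] at hx
    obtain ⟨v, hv, rfl⟩ := hx
    exact ⟨v, hv, rfl⟩
  have f1 := F_base (fun x hx => (hin x (Or.inl hx)).imp fun _ h => h.2) hz1
  have f2 := F_base (fun x hx => (hin x (Or.inr hx)).imp fun _ h => h.2) hz2
  have hd : Disjoint (base (P₁ : Set (Pt n))) (base (P₂ : Set (Pt n))) := by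
    rw [Finset.disjoint_left]
    intro v h1 h2
    simp only [base, Finset.mem_filter, Finset.mem_univ, true_and, Finset.mem_coe] at h1 h2
    exact Finset.disjoint_left.1 hD h1 h2
  have hs : base (P₁ : Set (Pt n)) ∪ base (P₂ : Set (Pt n)) ⊆ Q := by
    intro v hv
    simp only [base, Finset.mem_union, Finset.mem_filter, Finset.mem_univ, true_and,
      Finset.mem_coe] at hv
    obtain ⟨w, hw, e⟩ := hin _ hv
    rwa [Sum.inl_injective e]
  have hc := Finset.card_le_card hs
  rw [Finset.card_union_of_disjoint hd, hQ] at hc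
  rcases z with v | E
  · exact Finset.disjoint_left.1 hd f1 f2
  · have g1 : 2 ≤ (base (P₁ : Set (Pt n))).card := by
      rcases F_cases f1 with h | h
      · exact (E.2.2.1 _ h).ge
      · omega
    have g2 : 2 ≤ (base (P₂ : Set (Pt n))).card := by
      rcases F_cases f2 with h | h
      · exact (E.2.2.1 _ h).ge
      · omega
    omega

lemma no_packing {k : ℕ} (hk : 3 ≤ k) (z : Pt (3 * k - 2)) (S : Fin k → Finset (Fin (3 * k - 2)))
    (hd : ∀ i j, i ≠ j → Disjoint (S i) (S j)) (hS : ∀ i, F z (S i)) : False := by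
  rcases z with a | E
  · have : (⟨0, by omega⟩ : Fin k) ≠ ⟨1, by omega⟩ := by simp
    exact Finset.disjoint_left.1 (hd _ _ this) (hS _) (hS _)
  · have htot : ∑ i, (S i).card ≤ 3 * k - 2 := by
      rw [← Finset.card_biUnion (fun i _ j _ h => hd i j h)]
      exact (Finset.card_le_univ _).trans (by simp)
    have hone : ∀ i j, (S i).card < 3 → (S j).card < 3 → i = j := by
      intro i j hi hj
      by_contra hij
      have ei : S i ∈ E.1 := (F_cases (hS i)).resolve_right (by omega)
      have ej : S j ∈ E.1 := (F_cases (hS j)).resolve_right (by omega)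
      have hne : S i ≠ S j := by
        intro h
        have h1 := hd i j hij
        rw [← h, disjoint_self] at h1
        have := E.2.2.1 _ ei
        rw [h1] at this
        simp at this
      obtain ⟨l, hl⟩ : ∃ l : Fin k, l ∉ ({i, j} : Finset (Fin k)) := by
        by_contra! h
        have h1 := Finset.card_le_card (fun x _ => h x : Finset.univ ⊆ ({i, j} : Finset (Fin k)))
        have h2 : ({i, j} : Finset (Fin k)).card ≤ 2 := Finset.card_le_two
        simp at h1
        omega
      simp only [Finset.mem_insert, Finset.mem_singleton, not_or] at hl
      have htouch : ∃ e ∈ E.1, ∃ v ∈ e, v ∈ S l := by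
        rcases hS l with ⟨e, he, hes⟩ | ⟨_, h | h⟩
        · obtain ⟨v, hv⟩ : e.Nonempty := Finset.card_pos.1 (by rw [E.2.2.1 e he]; omega)
          exact ⟨e, he, v, hv, hes hv⟩
        · exact absurd (Finset.card_le_one.1 h _ ei _ ej) hne
        · exact h
      obtain ⟨e, he, v, hve, hvl⟩ := htouch
      rcases three_eq E ei ej he with h | h | h
      · exact hne h
      · exact Finset.disjoint_left.1 (hd l i hl.1) hvl (h ▸ hve)
      · exact Finset.disjoint_left.1 (hd l j hl.2) hvl (h ▸ hve)
    have h2 : ∀ i, 2 ≤ (S i).card := by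
      intro i
      rcases F_cases (hS i) with h | h
      · exact (E.2.2.1 _ h).ge
      · omega
    have hlow : ∑ _i : Fin k, 3 ≤ ∑ i, (S i).card + 1 := by
      by_cases hex : ∃ i, (S i).card < 3
      · obtain ⟨i, hi⟩ := hex
        rw [← Finset.add_sum_erase _ _ (Finset.mem_univ i),
          ← Finset.add_sum_erase Finset.univ (fun i => (S i).card) (Finset.mem_univ i)]
        have := Finset.sum_le_sum (s := Finset.univ.erase i) (f := fun _ => 3)
          (g := fun i => (S i).card) (by
            intro j hj
            by_contra h
            exact (Finset.mem_erase.1 hj).1 (hone j i (by simpa using h) hi))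
        have := h2 i
        omega
      · push Not at hex
        have := Finset.sum_le_sum (s := Finset.univ) (fun i _ => hex i)
        omega
    simp at hlow
    omega

end Bukh

/-- **Bukh's counterexample to the partition conjecture** ([bukh]).
For every `k ≥ 3` there is a convexity space whose Radon number equals `4` (it has Radon
number at most `4` but not at most `3`) and whose `k`-th partition number is at least
`3k - 1`: there is a multiset `Y` of cardinality `3k - 2` (with multiplicities) admitting no
partition into `k` nonempty parts whose convex hulls have a common point. In particular the
inequality `r_k ≤ (k-1)(r₂-1) + 1` fails in general. -/
theorem bukh_partition_counterexample (k : ℕ) (hk : 3 ≤ k) :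
    ∃ (X : Type) (_ : Nonempty X) (CS : ConvexitySpace X),
      CS.RadonLE 4 ∧ ¬ CS.RadonLE 3 ∧
      ∃ Y : Multiset X, Multiset.card Y = 3 * k - 2 ∧
        ¬ ∃ f : Fin k → Multiset X,
            (∀ i, f i ≠ 0) ∧ (∑ i, f i) = Y ∧
            (⋂ i, CS.hull {x | x ∈ f i}).Nonempty := by
  refine ⟨Bukh.Pt (3 * k - 2), ⟨Sum.inl ⟨0, by omega⟩⟩, Bukh.CS _, Bukh.radon4,
    Bukh.not_radon3 (by omega),
    ((Finset.univ : Finset (Fin (3 * k - 2))).map ⟨Sum.inl, Sum.inl_injective⟩).val, by simp, ?_⟩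
  rintro ⟨f, -, hsum, z, hz⟩
  rw [Set.mem_iInter] at hz
  have hle : ∀ i x, x ∈ f i → ∃ v, x = Sum.inl v := by
    intro i x hx
    have : x ∈ ∑ i, f i := Multiset.mem_of_le
      (Finset.single_le_sum (f := f) (fun _ _ => zero_le) (Finset.mem_univ i)) hx
    rw [hsum] at this
    simp only [Finset.mem_val, Finset.mem_map, Finset.mem_univ, true_and] at this
    obtain ⟨v, rfl⟩ := this
    exact ⟨v, rfl⟩
  refine Bukh.no_packing hk z (fun i => Bukh.base {x | x ∈ f i}) ?_
    (fun i => Bukh.F_base (hle i) (hz i))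
  intro i j hij
  rw [Finset.disjoint_left]
  intro v h1 h2
  simp only [Bukh.base, Finset.mem_filter, Finset.mem_univ, true_and, Set.mem_ofPred_eq] at h1 h2
  have hnd : (∑ i, f i).Nodup := by rw [hsum]; exact Finset.nodup _
  have hle2 : f i + f j ≤ ∑ i, f i := by
    rw [← Finset.sum_pair hij]
    exact Finset.sum_le_sum_of_subset (Finset.subset_univ _)
  have := Multiset.nodup_of_le hle2 hnd
  exact Multiset.disjoint_left.1 (Multiset.nodup_add.1 this).2.2 h1 h2
end
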